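/- arXiv:2306.10428 — 2 statements merged into one kernel-verified Lean document; each statement's English description precedes it below -/
import Mathlib

section
/- There is a universal constant C > 0 such that for every ε > 0, β ∈ (0,1), and integers d, T ≥ 1, there exists an ε-differentially private (event level) continual-observation mechanism M with input universe {0,1}^d, output space ℝ^d and stream length T such that for every input stream x, with M(x)-probability at least 1 − β, the output sequence (a^1,…,a^T) satisfies |a^t_i − h^t(x)_i| ≤ C · ε^{-1} · ( d·log²(d·n_max(x)/β) + log T ) for all t ≤ T and i ≤ d, where n_max(x) = max_{i ≤ d} h^T(x)_i is the maximum column sum of x (the Histogram problem under continual observation). -/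
open MeasureTheory

/-- Base-2 logarithm where the argument is clamped below by 2. -/
noncomputable def log2c (z : ℝ) : ℝ := Real.logb 2 (max z 2)

/-- The histogram of a stream of rows from `{0,1}^d` at time step `t`:
the `i`-th column sum of the first `t+1` rows (time steps are 0-indexed). -/
def hist {d T : ℕ} (x : Fin T → Fin d → Bool) (t : Fin T) (i : Fin d) : ℕ :=
  ∑ s : Fin T, if s ≤ t ∧ x s i then 1 else 0

/-- Two streams differ in at most one time step (event-level neighboring). -/
def EventNeighboring {X : Type*} {T : ℕ} (x y : Fin T → X) : Prop :=
  ∃ t₀ : Fin T, ∀ s : Fin T, s ≠ t₀ → x s = y s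

/-- A continual-observation mechanism: a measurable assignment of output
distributions to input streams whose outputs up to time `t` depend only on the
first `t` inputs. -/
def IsCOMech {X O : Type*} [MeasurableSpace X] [MeasurableSpace O] {T : ℕ}
    (M : (Fin T → X) → Measure (Fin T → O)) : Prop :=
  Measurable M ∧ (∀ x, IsProbabilityMeasure (M x)) ∧
    ∀ (t : Fin T) (x y : Fin T → X), (∀ s, s ≤ t → x s = y s) →
      (M x).map (fun a (s : {s : Fin T // s ≤ t}) => a s.1) =
      (M y).map (fun a (s : {s : Fin T // s ≤ t}) => a s.1)

/-- `ε`-differential privacy (event level) for a continual-observation mechanism. -/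
def IsEventDP {X O : Type*} [MeasurableSpace X] [MeasurableSpace O] {T : ℕ} (ε : ℝ)
    (M : (Fin T → X) → Measure (Fin T → O)) : Prop :=
  ∀ x y, EventNeighboring x y → ∀ S : Set (Fin T → O), MeasurableSet S →
    M x S ≤ ENNReal.ofReal (Real.exp ε) * M y S

/-- The last (0-indexed) time step of a stream of length `T ≥ 1`. -/
def lastIdx (T : ℕ) (hT : 1 ≤ T) : Fin T := ⟨T - 1, Nat.sub_lt hT Nat.one_pos⟩


namespace HCO

/-- Density of i.i.d. standard Laplace noise. -/
noncomputable def dens {ι : Type*} [Fintype ι] (z : ι → ℝ) : ℝ := ∏ i, (Real.exp (-|z i|) / 2)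

/-- Law of i.i.d. standard Laplace noise. -/
noncomputable def noise (ι : Type*) [Fintype ι] : Measure (ι → ℝ) :=
  (volume : Measure (ι → ℝ)).withDensity (fun z => ENNReal.ofReal (dens z))

lemma integral_lap {c : ℝ} (hc : 0 < c) : ∫ x : ℝ, Real.exp (-(c * |x|)) = 2 / c := by
  rw [integral_comp_abs (f := fun x => Real.exp (-(c * x)))]
  have := integral_exp_mul_Ioi (a := -c) (by linarith) 0
  simp only [neg_mul] at this
  rw [this]
  simp
  ring

lemma integrable_lap {c : ℝ} (hc : 0 < c) : Integrable (fun x : ℝ => Real.exp (-(c * |x|))) := by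
  by_contra h
  have h1 := integral_undef h
  rw [integral_lap hc] at h1
  have : 0 < 2 / c := by positivity
  linarith

lemma dens_measurable {ι : Type*} [Fintype ι] : Measurable (dens : (ι → ℝ) → ℝ) := by
  unfold dens
  fun_prop

lemma dens_nonneg {ι : Type*} [Fintype ι] (z : ι → ℝ) : 0 ≤ dens z := by
  unfold dens
  positivity

/-- Exponential moments. -/
lemma noise_mgf {ι : Type*} [Fintype ι] [DecidableEq ι] (J : Finset ι) :
    ∫⁻ z, ENNReal.ofReal (Real.exp ((∑ j ∈ J, |z j|) / 2)) ∂(noise ι) = 2 ^ J.card := by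
  unfold noise
  rw [lintegral_withDensity_eq_lintegral_mul _ (dens_measurable.ennreal_ofReal) (by fun_prop)]
  let g : ι → ℝ → ℝ := fun i x =>
    if i ∈ J then Real.exp (-(2⁻¹ * |x|)) / 2 else Real.exp (-(1 * |x|)) / 2
  have hg : ∀ z : ι → ℝ, ((fun z : ι → ℝ => ENNReal.ofReal (dens z)) *
      fun z : ι → ℝ => ENNReal.ofReal (Real.exp ((∑ j ∈ J, |z j|) / 2))) z
        = ENNReal.ofReal (∏ i, g i (z i)) := by
    intro z
    simp only [Pi.mul_apply]
    rw [← ENNReal.ofReal_mul (dens_nonneg z)]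
    congr 1
    have : Real.exp ((∑ j ∈ J, |z j|) / 2) = ∏ i, if i ∈ J then Real.exp (|z i| / 2) else 1 := by
      rw [Finset.sum_div, Real.exp_sum, Finset.prod_ite_mem, Finset.univ_inter]
    rw [this, dens, ← Finset.prod_mul_distrib]
    apply Finset.prod_congr rfl
    intro i _
    simp only [g]
    split_ifs
    · rw [div_mul_eq_mul_div, ← Real.exp_add]
      congr 2
      ring
    · simp
  have hgi : ∀ i, Integrable (g i) := by
    intro i
    by_cases h : i ∈ J
    · simp only [g, h, if_true]
      exact (integrable_lap (by norm_num)).div_const 2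
    · simp only [g, h, if_false]
      exact (integrable_lap (by norm_num)).div_const 2
  rw [lintegral_congr hg, ← ofReal_integral_eq_lintegral_ofReal]
  · rw [integral_fintype_prod_volume_eq_prod]
    have : ∀ i, ∫ x, g i x = if i ∈ J then 2 else 1 := by
      intro i
      by_cases h : i ∈ J
      · simp only [g, h, if_true]
        rw [integral_div, integral_lap (by norm_num)]
        norm_num
      · simp only [g, h, if_false]
        rw [integral_div, integral_lap (by norm_num)]
        norm_num
    simp only [this]
    rw [Finset.prod_ite_mem, Finset.univ_inter]
    simp
  · exact Integrable.fintype_prod hgi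
  · filter_upwards with z
    apply Finset.prod_nonneg
    intro i _
    simp only [g]
    split_ifs <;> positivity

instance noise_prob (ι : Type*) [Fintype ι] : IsProbabilityMeasure (noise ι) := by
  classical
  constructor
  have := noise_mgf (ι := ι) ∅
  simpa using this

lemma noise_tail {ι : Type*} [Fintype ι] [DecidableEq ι] (J : Finset ι) (k : ℕ) (hk : J.card ≤ k)
    (s : ℝ) :
    noise ι {z | s < ∑ j ∈ J, |z j|} ≤ ENNReal.ofReal (2 ^ k * Real.exp (-(s / 2))) := by
  have h := mul_meas_ge_le_lintegral (μ := noise ι)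
    (f := fun z => ENNReal.ofReal (Real.exp ((∑ j ∈ J, |z j|) / 2))) (by fun_prop)
    (ENNReal.ofReal (Real.exp (s / 2)))
  rw [noise_mgf] at h
  have h2 : noise ι {z | s < ∑ j ∈ J, |z j|} ≤ noise ι {z | ENNReal.ofReal (Real.exp (s / 2)) ≤
      ENNReal.ofReal (Real.exp ((∑ j ∈ J, |z j|) / 2))} := by
    apply measure_mono
    intro z hz
    simp only [Set.mem_ofPred_eq] at hz ⊢
    apply ENNReal.ofReal_le_ofReal
    apply Real.exp_le_exp.2
    linarith
  calc _ ≤ _ := h2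
    _ = ENNReal.ofReal (Real.exp (-(s / 2))) * (ENNReal.ofReal (Real.exp (s / 2)) * noise ι {z | ENNReal.ofReal (Real.exp (s / 2)) ≤
      ENNReal.ofReal (Real.exp ((∑ j ∈ J, |z j|) / 2))}) := by
        rw [← mul_assoc, ← ENNReal.ofReal_mul (by positivity), ← Real.exp_add]
        simp
    _ ≤ ENNReal.ofReal (Real.exp (-(s / 2))) * 2 ^ J.card := by gcongr
    _ ≤ ENNReal.ofReal (Real.exp (-(s / 2))) * 2 ^ k := by
        gcongr
        norm_num
    _ = _ := by
        rw [mul_comm, ENNReal.ofReal_mul (by positivity), ENNReal.ofReal_pow (by norm_num)]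
        simp

lemma noise_shift {ι : Type*} [Fintype ι] (v : ι → ℝ) (ε : ℝ) (hv : ∑ i, |v i| ≤ ε)
    (A B : Set (ι → ℝ)) (hB : MeasurableSet B) (hA : MeasurableSet A)
    (hAB : ∀ z ∈ A, z + v ∈ B) :
    noise ι A ≤ ENNReal.ofReal (Real.exp ε) * noise ι B := by
  have h1 : ∀ z : ι → ℝ, dens z ≤ Real.exp ε * dens (z + v) := by
    intro z
    calc dens z = ∏ i, (Real.exp (-|z i|) / 2) := rfl
      _ ≤ ∏ i, (Real.exp |v i| * (Real.exp (-|(z + v) i|) / 2)) := by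
        apply Finset.prod_le_prod
        · intro i _; positivity
        · intro i _
          rw [← mul_div_assoc, ← Real.exp_add]
          have : |(z + v) i| ≤ |z i| + |v i| := abs_add_le _ _
          have : -|z i| ≤ |v i| + -|(z + v) i| := by linarith
          have := Real.exp_le_exp.2 this
          linarith
      _ = Real.exp (∑ i, |v i|) * dens (z + v) := by
        rw [Finset.prod_mul_distrib, Real.exp_sum]; rfl
      _ ≤ _ := by
        have := dens_nonneg (z + v)
        gcongr
  unfold noise
  rw [withDensity_apply _ hA, withDensity_apply _ hB, ← lintegral_indicator hA,
    ← lintegral_indicator hB, ← lintegral_const_mul _ ((dens_measurable.ennreal_ofReal).indicator hB),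
    ← lintegral_add_right_eq_self (fun a => ENNReal.ofReal (Real.exp ε) *
      B.indicator (fun a => ENNReal.ofReal (dens a)) a) v]
  apply lintegral_mono
  intro z
  by_cases hz : z ∈ A
  · simp only [Set.indicator_of_mem hz, Set.indicator_of_mem (hAB z hz)]
    rw [← ENNReal.ofReal_mul (by positivity)]
    exact ENNReal.ofReal_le_ofReal (h1 z)
  · simp [Set.indicator_of_notMem hz]

end HCO

namespace HCO

/-- Node at level `l` containing `i` is used for the prefix `j`. -/
def P (i j l : ℕ) : Prop :=
  l < Nat.log 2 j ∧ (i / 2 ^ l = 1 ∨ (i / 2 ^ l + 1 = j / 2 ^ l ∧ (j / 2 ^ l) % 2 = 1))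

instance (i j l : ℕ) : Decidable (P i j l) := by unfold P; infer_instance

lemma two_le_div {j l : ℕ} (h : l < Nat.log 2 j) : 2 ≤ j / 2 ^ l := by
  have hj : j ≠ 0 := by rintro rfl; simp at h
  have h1 : 2 ^ (l + 1) ≤ j := Nat.pow_le_of_le_log hj h
  rw [Nat.le_div_iff_mul_le (by positivity)]
  rw [pow_succ] at h1
  omega

lemma P_succ (i j l : ℕ) (hj : 2 ≤ j) : P i j (l + 1) ↔ P (i / 2) (j / 2) l := by
  unfold P
  have h1 : Nat.log 2 j = Nat.log 2 (j / 2) + 1 := Nat.log_of_one_lt_of_le (by norm_num) hj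
  rw [h1, pow_succ', ← Nat.div_div_eq_div_mul, ← Nat.div_div_eq_div_mul]
  simp

lemma not_P_zero (j l : ℕ) : ¬ P 0 j l := by
  rintro ⟨h, h2⟩
  have := two_le_div h
  simp at h2
  omega

lemma P_count (K : ℕ) : ∀ i j : ℕ, 1 ≤ i → j < 2 ^ K →
    (∑ l ∈ Finset.range K, if P i j l then 1 else 0) = if i < j then 1 else 0 := by
  induction K with
  | zero =>
    intro i j hi hj
    simp at hj
    subst hj
    simp
  | succ K ih =>
    intro i j hi hj
    rw [Finset.sum_range_succ']
    by_cases hj2 : 2 ≤ j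
    · simp only [P_succ i j _ hj2]
      have hl : 0 < Nat.log 2 j := Nat.log_pos (by norm_num) hj2
      have h0 : P i j 0 ↔ (i = 1 ∨ (i + 1 = j ∧ j % 2 = 1)) := by
        unfold P; simp [hl]
      by_cases hi1 : i = 1
      · subst hi1
        have : ∀ l, ¬ P (1 / 2) (j / 2) l := fun l => not_P_zero _ _
        simp only [this, h0]
        simp
        omega
      · rw [ih (i / 2) (j / 2) (by omega) (by rw [pow_succ] at hj; omega)]
        simp only [h0]
        split_ifs <;> omega
    · have : ∀ l, ¬ P i j l := by
        rintro l ⟨h, -⟩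
        have : Nat.log 2 j = 0 := Nat.log_of_lt (by omega)
        omega
      simp only [this]
      simp
      omega

/-- Nodes used to compose the noise of the prefix `j`. -/
def nodes (N j : ℕ) : Finset (Fin N × Fin N) :=
  Finset.univ.filter fun m => m.1.val < Nat.log 2 j ∧
    (m.2.val = 1 ∨ (m.2.val + 1 = j / 2 ^ m.1.val ∧ (j / 2 ^ m.1.val) % 2 = 1))

lemma nodes_count (N i j : ℕ) (hi : 1 ≤ i) (hiN : i < N) (hj : j < N) :
    (∑ m ∈ nodes N j, if m.2.val = i / 2 ^ m.1.val then (1 : ℝ) else 0) =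
      if i < j then 1 else 0 := by
  have h := P_count N i j hi (hj.trans Nat.lt_two_pow_self)
  have h' : (∑ l ∈ Finset.range N, if P i j l then (1 : ℝ) else 0) = if i < j then 1 else 0 := by
    have := congrArg (Nat.cast : ℕ → ℝ) h
    push_cast at this
    exact this
  rw [← h', ← Fin.sum_univ_eq_sum_range (fun l => if P i j l then (1 : ℝ) else 0), nodes,
    Finset.sum_filter, Fintype.sum_prod_type]
  apply Finset.sum_congr rfl
  intro l _
  have hlt : i / 2 ^ l.val < N := (Nat.div_le_self _ _).trans_lt hiN
  rw [Finset.sum_eq_single (⟨i / 2 ^ l.val, hlt⟩ : Fin N)]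
  · simp [P]
  · intro q _ hq
    have : q.val ≠ i / 2 ^ l.val := fun h => hq (Fin.ext h)
    simp [this]
  · simp

lemma nodes_card (N j : ℕ) : (nodes N j).card ≤ 2 * Nat.log 2 j := by
  have : (nodes N j).card ≤ (Finset.range (Nat.log 2 j) ×ˢ (Finset.univ : Finset Bool)).card := by
    apply Finset.card_le_card_of_injOn (fun m => (m.1.val, decide (m.2.val = 1)))
    · intro m hm
      simp [nodes] at hm
      simp [hm.1]
      exact em _
    · intro m hm m' hm' h
      simp [nodes] at hm hm'
      simp only [Prod.mk.injEq, decide_eq_decide] at h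
      obtain ⟨h1, h2⟩ := h
      rw [← h1] at hm'
      apply Prod.ext
      · exact Fin.ext h1
      · apply Fin.ext
        omega
  simpa [mul_comm] using this

lemma nodes_pos {N j : ℕ} {m : Fin N × Fin N} (hm : m ∈ nodes N j) : 1 ≤ m.2.val := by
  simp [nodes] at hm
  have := two_le_div hm.1
  omega

lemma nodes_log {N j : ℕ} {m : Fin N × Fin N} (hm : m ∈ nodes N j) :
    m.1.val + Nat.log 2 m.2.val ≤ Nat.log 2 j := by
  simp [nodes] at hm
  obtain ⟨h1, h2 | h2⟩ := hm
  · rw [h2]; simp; omega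
  · have : Nat.log 2 m.2.val ≤ Nat.log 2 (j / 2 ^ m.1.val) := Nat.log_mono_right (by omega)
    rw [Nat.log_div_base_pow] at this
    omega

lemma tree_cost (N i : ℕ) :
    (∑ l : Fin N, ∑ q : Fin N, if q.val = i / 2 ^ l.val ∧ 1 ≤ q.val then
      (1 / ((l.val : ℝ) + Nat.log 2 q.val + 1)) else 0) ≤ 1 := by
  have h1 : ∀ l : Fin N, (∑ q : Fin N, if q.val = i / 2 ^ l.val ∧ 1 ≤ q.val then
      (1 / ((l.val : ℝ) + Nat.log 2 q.val + 1)) else 0) ≤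
      (fun l : ℕ => if l < Nat.log 2 i + 1 then 1 / ((Nat.log 2 i : ℝ) + 1) else 0) l.val := by
    intro l
    by_cases hlt : i / 2 ^ l.val < N ∧ 1 ≤ i / 2 ^ l.val
    · rw [Finset.sum_eq_single (⟨i / 2 ^ l.val, hlt.1⟩ : Fin N)]
      · have hl : l.val ≤ Nat.log 2 i := by
          apply Nat.le_log_of_pow_le (by norm_num)
          have := (Nat.le_div_iff_mul_le (by positivity)).1 hlt.2
          omega
        have e : ((Nat.log 2 i : ℕ) : ℝ) = l.val + ((Nat.log 2 i - l.val : ℕ) : ℝ) := by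
          rw [Nat.cast_sub hl]; ring
        have h3 : l.val < Nat.log 2 i + 1 := by omega
        simp only [hlt.2, h3, if_true, true_and, Nat.log_div_base_pow]
        rw [e]
      · intro q _ hq
        have : q.val ≠ i / 2 ^ l.val := fun h => hq (Fin.ext h)
        simp [this]
      · simp
    · rw [Finset.sum_eq_zero]
      · simp only
        split_ifs <;> positivity
      · intro q _
        rw [if_neg]
        rintro ⟨ha, hb⟩
        exact hlt ⟨ha ▸ q.2, ha ▸ hb⟩
  calc _ ≤ ∑ l : Fin N, (fun l : ℕ => if l < Nat.log 2 i + 1 then 1 / ((Nat.log 2 i : ℝ) + 1) else 0) l.val :=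
        Finset.sum_le_sum fun l _ => h1 l
    _ = ∑ l ∈ Finset.range N, if l < Nat.log 2 i + 1 then 1 / ((Nat.log 2 i : ℝ) + 1) else 0 :=
        Fin.sum_univ_eq_sum_range (fun l : ℕ => if l < Nat.log 2 i + 1 then 1 / ((Nat.log 2 i : ℝ) + 1) else 0) N
    _ = ∑ l ∈ (Finset.range N).filter (fun l => l < Nat.log 2 i + 1), 1 / ((Nat.log 2 i : ℝ) + 1) := by
        rw [Finset.sum_filter]
    _ ≤ ∑ l ∈ Finset.range (Nat.log 2 i + 1), 1 / ((Nat.log 2 i : ℝ) + 1) := by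
        apply Finset.sum_le_sum_of_subset_of_nonneg
        · intro l hl
          simp at hl ⊢
          omega
        · intros; positivity
    _ = 1 := by
        simp
        field_simp

/-- Largest column increment since time `s`. -/
def D {d : ℕ} (H : ℕ → Fin d → ℕ) (n s : ℕ) : ℕ := Finset.univ.sup fun i => H (n + 1) i - H s i

open Classical in
/-- State (segment index, last closing time). -/
noncomputable def st {d : ℕ} (H : ℕ → Fin d → ℕ) (ν ρ : ℕ → ℝ) (τ : ℝ) : ℕ → ℕ × ℕ
  | 0 => (1, 0)
  | n + 1 => if τ + ρ (st H ν ρ τ n).1 ≤ (D H n (st H ν ρ τ n).2 : ℝ) + ν n then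
      ((st H ν ρ τ n).1 + 1, n + 1) else st H ν ρ τ n

section
variable {d : ℕ} (H : ℕ → Fin d → ℕ) (ν ρ : ℕ → ℝ) (τ : ℝ)

lemma st_succ_cases (n : ℕ) : (st H ν ρ τ (n + 1) = ((st H ν ρ τ n).1 + 1, n + 1) ∧
      τ + ρ (st H ν ρ τ n).1 ≤ (D H n (st H ν ρ τ n).2 : ℝ) + ν n) ∨
    (st H ν ρ τ (n + 1) = st H ν ρ τ n ∧
      (D H n (st H ν ρ τ n).2 : ℝ) + ν n < τ + ρ (st H ν ρ τ n).1) := by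
  rw [st]
  split_ifs with h
  · exact Or.inl ⟨rfl, h⟩
  · exact Or.inr ⟨rfl, not_le.1 h⟩

lemma st_bounds (n : ℕ) : (st H ν ρ τ n).2 ≤ n ∧ 1 ≤ (st H ν ρ τ n).1 ∧ (st H ν ρ τ n).1 ≤ n + 1 := by
  induction n with
  | zero => simp [st]
  | succ n ih =>
    rcases st_succ_cases H ν ρ τ n with ⟨h, -⟩ | ⟨h, -⟩ <;> rw [h]
    · simp; omega
    · omega

lemma st_mono {m n : ℕ} (h : m ≤ n) : st H ν ρ τ m = st H ν ρ τ n ∨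
    ((st H ν ρ τ m).1 < (st H ν ρ τ n).1 ∧ m < (st H ν ρ τ n).2) := by
  induction n, h using Nat.le_induction with
  | base => exact Or.inl rfl
  | succ n hmn ih =>
    rcases st_succ_cases H ν ρ τ n with ⟨h, -⟩ | ⟨h, -⟩ <;> rw [h]
    · right
      rcases ih with ih | ih
      · rw [ih]; simp; omega
      · simp; omega
    · exact ih

lemma st_causal (H' : ℕ → Fin d → ℕ) (n : ℕ) (h : ∀ m ≤ n, H m = H' m) :
    st H ν ρ τ n = st H' ν ρ τ n := by
  induction n with
  | zero => rfl
  | succ n ih =>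
    have ih := ih (fun m hm => h m (by omega))
    have := st_bounds H' ν ρ τ n
    have hD : D H n (st H' ν ρ τ n).2 = D H' n (st H' ν ρ τ n).2 := by
      unfold D
      rw [h (n + 1) le_rfl, h _ (by omega)]
    rw [st, st, ih, hD]

end

lemma st_shift {d : ℕ} (Hx Hy : ℕ → Fin d → ℕ) (ν ρ ν' ρ' : ℕ → ℝ) (τ : ℝ) (t₀ T : ℕ)
    (Δ : Fin d → ℤ) (hΔ : ∀ i, |Δ i| ≤ 1)
    (hH : ∀ m i, (Hx m i : ℤ) = Hy m i + if t₀ < m then Δ i else 0)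
    (hρ : ∀ j ≤ T + 1, ρ' j = ρ j + if j = (st Hx ν ρ τ t₀).1 then 1 else 0)
    (hν : ∀ n < T, ν' n = ν n + if (st Hx ν ρ τ n).1 = (st Hx ν ρ τ t₀).1 ∧
      (st Hx ν ρ τ (n + 1)).1 = (st Hx ν ρ τ t₀).1 + 1 then 2 else 0)
    (n : ℕ) (hn : n ≤ T) : st Hy ν' ρ' τ n = st Hx ν ρ τ n := by
  induction n with
  | zero => rfl
  | succ n ih =>
    have ih := ih (by omega)
    obtain ⟨b1, b2, b3⟩ := st_bounds Hx ν ρ τ n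
    have hmono : t₀ ≤ n → _ := st_mono Hx ν ρ τ (m := t₀) (n := n)
    have hν := hν n (by omega)
    have hρ := hρ (st Hx ν ρ τ n).1 (by omega)
    have hs := st_succ_cases Hx ν ρ τ n
    have key1 : D Hx n (st Hx ν ρ τ n).2 ≤ D Hy n (st Hx ν ρ τ n).2 + 1 := by
      unfold D
      apply Finset.sup_le
      intro i _
      have h1 : Hy (n + 1) i - Hy (st Hx ν ρ τ n).2 i ≤
        Finset.univ.sup fun i => Hy (n + 1) i - Hy (st Hx ν ρ τ n).2 i :=
          Finset.le_sup (f := fun i => Hy (n + 1) i - Hy (st Hx ν ρ τ n).2 i) (Finset.mem_univ i)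
      have h2 := hH (n + 1) i
      have h3 := hH (st Hx ν ρ τ n).2 i
      have h4 := abs_le.1 (hΔ i)
      split_ifs at h2 h3 <;> omega
    have key2 : D Hy n (st Hx ν ρ τ n).2 ≤ D Hx n (st Hx ν ρ τ n).2 + 1 := by
      unfold D
      apply Finset.sup_le
      intro i _
      have h1 : Hx (n + 1) i - Hx (st Hx ν ρ τ n).2 i ≤
        Finset.univ.sup fun i => Hx (n + 1) i - Hx (st Hx ν ρ τ n).2 i :=
          Finset.le_sup (f := fun i => Hx (n + 1) i - Hx (st Hx ν ρ τ n).2 i) (Finset.mem_univ i)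
      have h2 := hH (n + 1) i
      have h3 := hH (st Hx ν ρ τ n).2 i
      have h4 := abs_le.1 (hΔ i)
      split_ifs at h2 h3 <;> omega
    have key3 : (st Hx ν ρ τ n).1 ≠ (st Hx ν ρ τ t₀).1 →
        D Hx n (st Hx ν ρ τ n).2 = D Hy n (st Hx ν ρ τ n).2 := by
      intro hne
      unfold D
      congr 1
      funext i
      have h2 := hH (n + 1) i
      have h3 := hH (st Hx ν ρ τ n).2 i
      by_cases hle : t₀ ≤ n
      · rcases hmono hle with h | h
        · exact absurd (by rw [h]) hne
        · rw [if_pos (by omega)] at h2 h3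
          omega
      · rw [if_neg (by omega)] at h2 h3
        omega
    have key1' : (D Hx n (st Hx ν ρ τ n).2 : ℝ) ≤ D Hy n (st Hx ν ρ τ n).2 + 1 := by
      exact_mod_cast key1
    have key2' : (D Hy n (st Hx ν ρ τ n).2 : ℝ) ≤ D Hx n (st Hx ν ρ τ n).2 + 1 := by
      exact_mod_cast key2
    rw [st, ih]
    by_cases hj : (st Hx ν ρ τ n).1 = (st Hx ν ρ τ t₀).1
    · rw [if_pos hj] at hρ
      rcases hs with ⟨h, h'⟩ | ⟨h, h'⟩
      · rw [if_pos ⟨hj, by rw [h, hj]⟩] at hν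
        rw [h, if_pos]
        linarith
      · rw [if_neg (by rintro ⟨-, h2⟩; rw [h] at h2; omega)] at hν
        rw [h, if_neg]
        linarith
    · rw [if_neg hj] at hρ
      rw [if_neg (fun h => hj h.1)] at hν
      rw [← key3 hj]
      rcases hs with ⟨h, h'⟩ | ⟨h, h'⟩
      · rw [h, if_pos]
        linarith
      · rw [h, if_neg]
        linarith

end HCO

namespace HCO

/-- Prefix sums. -/
def H {d T : ℕ} (x : Fin T → Fin d → Bool) (n : ℕ) (i : Fin d) : ℕ :=
  ∑ s : Fin T, if s.val < n ∧ x s i then 1 else 0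

lemma hist_eq {d T : ℕ} (x : Fin T → Fin d → Bool) (t : Fin T) (i : Fin d) :
    hist x t i = H x (t.val + 1) i := by
  unfold hist H
  apply Finset.sum_congr rfl
  intro s _
  have : s ≤ t ↔ s.val < t.val + 1 := by rw [Fin.le_def]; omega
  simp only [this]

lemma H_mono {d T : ℕ} (x : Fin T → Fin d → Bool) {m n : ℕ} (h : m ≤ n) (i : Fin d) :
    H x m i ≤ H x n i := by
  unfold H
  apply Finset.sum_le_sum
  intro s _
  by_cases h1 : s.val < m ∧ x s i
  · rw [if_pos h1, if_pos ⟨by omega, h1.2⟩]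
  · rw [if_neg h1]; exact Nat.zero_le _

lemma H_zero {d T : ℕ} (x : Fin T → Fin d → Bool) (i : Fin d) : H x 0 i = 0 := by
  simp [H]

lemma H_causal {d T : ℕ} (x y : Fin T → Fin d → Bool) (t : Fin T) (h : ∀ s, s ≤ t → x s = y s)
    (m : ℕ) (hm : m ≤ t.val + 1) : H x m = H y m := by
  funext i
  unfold H
  apply Finset.sum_congr rfl
  intro s _
  by_cases hs : s.val < m
  · rw [h s (by rw [Fin.le_def]; omega)]
  · simp [hs]

lemma H_diff {d T : ℕ} (x y : Fin T → Fin d → Bool) (t₀ : Fin T) (h : ∀ s, s ≠ t₀ → x s = y s)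
    (m : ℕ) (i : Fin d) : (H x m i : ℤ) = H y m i +
      if t₀.val < m then ((x t₀ i).toNat : ℤ) - (y t₀ i).toNat else 0 := by
  unfold H
  rw [← Finset.add_sum_erase Finset.univ _ (Finset.mem_univ t₀),
    ← Finset.add_sum_erase Finset.univ (fun s : Fin T => if s.val < m ∧ y s i then 1 else 0)
      (Finset.mem_univ t₀)]
  have : ∑ s ∈ Finset.univ.erase t₀, (if s.val < m ∧ x s i = true then 1 else 0) =
      ∑ s ∈ Finset.univ.erase t₀, (if s.val < m ∧ y s i = true then 1 else 0) := by
    apply Finset.sum_congr rfl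
    intro s hs
    rw [h s (Finset.ne_of_mem_erase hs)]
  rw [this]
  by_cases hm : t₀.val < m
  · cases hx : x t₀ i <;> cases hy : y t₀ i <;> simp [hm] <;> ring
  · simp [hm]

/-- Index type of the noise. -/
abbrev Idx (d N : ℕ) := (Fin N × Fin N × Fin d) ⊕ (Fin N ⊕ Fin N)

noncomputable def nu {d T : ℕ} (ε : ℝ) (z : Idx d (T + 2) → ℝ) (n : ℕ) : ℝ :=
  6 / ε * z (Sum.inr (Sum.inl (Fin.ofNat (T + 2) n)))

noncomputable def rho {d T : ℕ} (ε : ℝ) (z : Idx d (T + 2) → ℝ) (n : ℕ) : ℝ :=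
  6 / ε * z (Sum.inr (Sum.inr (Fin.ofNat (T + 2) n)))

/-- noise scale of a node -/
noncomputable def wt (d : ℕ) (ε : ℝ) (l q : ℕ) : ℝ := 2 * d / ε * ((l : ℝ) + Nat.log 2 q + 1)

noncomputable def eta {d N : ℕ} (ε : ℝ) (z : Idx d N → ℝ) (j : ℕ) (i : Fin d) : ℝ :=
  ∑ m ∈ nodes N j, wt d ε m.1.val m.2.val * z (Sum.inl (m.1, m.2, i))

noncomputable def stx {d T : ℕ} (ε τ : ℝ) (x : Fin T → Fin d → Bool) (z : Idx d (T + 2) → ℝ) :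
    ℕ → ℕ × ℕ := st (H x) (nu ε z) (rho ε z) τ

noncomputable def out {d T : ℕ} (ε τ : ℝ) (x : Fin T → Fin d → Bool) (z : Idx d (T + 2) → ℝ)
    (t : Fin T) (i : Fin d) : ℝ :=
  (H x (stx ε τ x z (t.val + 1)).2 i : ℝ) + eta ε z (stx ε τ x z (t.val + 1)).1 i

lemma meas_comp {Ω : Type*} [MeasurableSpace Ω] (F : ℕ × ℕ → Ω → ℝ) (hF : ∀ p, Measurable (F p))
    (g : Ω → ℕ × ℕ) (hg : Measurable g) : Measurable fun z => F (g z) z := by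
  have : Measurable (fun q : (ℕ × ℕ) × Ω => F q.1 q.2) :=
    measurable_from_prod_countable_right hF
  exact this.comp (hg.prodMk measurable_id)

lemma stx_meas {d T : ℕ} (ε τ : ℝ) (x : Fin T → Fin d → Bool) (n : ℕ) :
    Measurable fun z => stx ε τ x z n := by
  induction n with
  | zero => exact measurable_const
  | succ n ih =>
    have : (fun z => stx ε τ x z (n + 1)) = fun z =>
      if τ + rho ε z (stx ε τ x z n).1 ≤ (D (H x) n (stx ε τ x z n).2 : ℝ) + nu ε z n then
      ((stx ε τ x z n).1 + 1, n + 1) else stx ε τ x z n := by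
      funext z
      rw [stx, st]
    rw [this]
    apply Measurable.ite _ _ ih
    · apply measurableSet_le
      · exact meas_comp (fun p z => τ + rho ε z p.1) (fun p => by unfold rho; fun_prop) _ ih
      · exact meas_comp (fun p z => (D (H x) n p.2 : ℝ) + nu ε z n)
          (fun p => by unfold nu; fun_prop) _ ih
    · exact (measurable_of_countable (fun p : ℕ × ℕ => (p.1 + 1, n + 1))).comp ih

lemma out_meas {d T : ℕ} (ε τ : ℝ) (x : Fin T → Fin d → Bool) : Measurable (out ε τ x) := by
  apply measurable_pi_lambda
  intro t
  apply measurable_pi_lambda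
  intro i
  exact meas_comp (fun p z => (H x p.2 i : ℝ) + eta ε z p.1 i)
    (fun p => by unfold eta; fun_prop) _ (stx_meas ε τ x _)

/-- The mechanism. -/
noncomputable def mech {d T : ℕ} (ε τ : ℝ) (x : Fin T → Fin d → Bool) :
    Measure (Fin T → Fin d → ℝ) := (noise (Idx d (T + 2))).map (out ε τ x)

lemma mech_CO {d T : ℕ} (ε τ : ℝ) : IsCOMech (mech (d := d) (T := T) ε τ) := by
  refine ⟨measurable_of_countable _, fun x => ?_, fun t x y h => ?_⟩
  · exact Measure.isProbabilityMeasure_map (out_meas ε τ x).aemeasurable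
  · unfold mech
    have hm : Measurable (fun (a : Fin T → Fin d → ℝ) (s : {s : Fin T // s ≤ t}) => a s.1) := by
      fun_prop
    rw [Measure.map_map hm (out_meas ε τ x), Measure.map_map hm (out_meas ε τ y)]
    congr 1
    funext z
    funext s
    funext i
    have hs : s.1.val ≤ t.val := s.2
    have e : stx ε τ x z (s.1.val + 1) = stx ε τ y z (s.1.val + 1) :=
      st_causal _ _ _ _ _ _ (fun m hm => H_causal x y t h m (by omega))
    have := (st_bounds (H y) (nu ε z) (rho ε z) τ (s.1.val + 1)).1
    simp only [Function.comp, out, e]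
    rw [H_causal x y t h _ (by unfold stx; omega)]

lemma sum_unique_le {N : ℕ} (c : Fin N → Prop) [DecidablePred c] (a : ℝ) (ha : 0 ≤ a)
    (hc : ∀ n n', c n → c n' → n = n') : (∑ n, if c n then a else 0) ≤ a := by
  rw [← Finset.sum_filter, Finset.sum_const, nsmul_eq_mul]
  have : (Finset.univ.filter c).card ≤ 1 := by
    apply Finset.card_le_one.2
    intro n hn n' hn'
    simp at hn hn'
    exact hc n n' hn hn'
  have : ((Finset.univ.filter c).card : ℝ) ≤ 1 := by exact_mod_cast this
  nlinarith

open Classical in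
/-- The shift vector. -/
noncomputable def shiftV {d N : ℕ} (ε : ℝ) (j₀ : ℕ) (c : Fin N → Prop) (Δ : Fin d → ℤ) :
    Idx d N → ℝ
  | Sum.inl (l, q, i) => if q.val = j₀ / 2 ^ l.val ∧ 1 ≤ q.val then Δ i / wt d ε l.val q.val else 0
  | Sum.inr (Sum.inl n) => if c n then ε / 3 else 0
  | Sum.inr (Sum.inr j) => if j.val = j₀ then ε / 6 else 0

lemma wt_pos {d : ℕ} {ε : ℝ} (hε : 0 < ε) (hd : 1 ≤ d) (l q : ℕ) : 0 < wt d ε l q := by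
  unfold wt
  have : (0 : ℝ) < d := by exact_mod_cast hd
  positivity

lemma shiftV_cost {d N : ℕ} {ε : ℝ} (hε : 0 < ε) (hd : 1 ≤ d) (j₀ : ℕ) (c : Fin N → Prop)
    (hc : ∀ n n', c n → c n' → n = n') (Δ : Fin d → ℤ) (hΔ : ∀ i, |Δ i| ≤ 1) :
    ∑ k, |shiftV ε j₀ c Δ k| ≤ ε := by
  classical
  have hd' : (0 : ℝ) < d := by exact_mod_cast hd
  rw [Fintype.sum_sum_type, Fintype.sum_sum_type]
  have h1 : ∑ k : Fin N × Fin N × Fin d, |shiftV ε j₀ c Δ (Sum.inl k)| ≤ ε / 2 := by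
    have hb : ∀ l q : Fin N, ∀ i : Fin d, |shiftV ε j₀ c Δ (Sum.inl (l, q, i))| ≤
        ε / (2 * d) * (if q.val = j₀ / 2 ^ l.val ∧ 1 ≤ q.val then
      (1 / ((l.val : ℝ) + Nat.log 2 q.val + 1)) else 0) := by
      intro l q i
      simp only [shiftV]
      split_ifs with h
      · rw [abs_div, abs_of_pos (wt_pos hε hd _ _)]
        have : |(Δ i : ℝ)| ≤ 1 := by exact_mod_cast hΔ i
        calc _ ≤ 1 / wt d ε l.val q.val := by
              have := wt_pos hε hd l.val q.val
              gcongr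
          _ = _ := by
              unfold wt
              field_simp
      · simp
    calc _ = ∑ l : Fin N, ∑ q : Fin N, ∑ i : Fin d, |shiftV ε j₀ c Δ (Sum.inl (l, q, i))| := by
          rw [Fintype.sum_prod_type]
          apply Finset.sum_congr rfl
          intro l _
          rw [Fintype.sum_prod_type]
      _ ≤ ∑ l : Fin N, ∑ q : Fin N, ∑ i : Fin d, ε / (2 * d) * (if q.val = j₀ / 2 ^ l.val ∧ 1 ≤ q.val then
      (1 / ((l.val : ℝ) + Nat.log 2 q.val + 1)) else 0) :=
          Finset.sum_le_sum fun l _ => Finset.sum_le_sum fun q _ => Finset.sum_le_sum fun i _ =>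
            hb l q i
      _ = ε / 2 * (∑ l : Fin N, ∑ q : Fin N, if q.val = j₀ / 2 ^ l.val ∧ 1 ≤ q.val then
      (1 / ((l.val : ℝ) + Nat.log 2 q.val + 1)) else 0) := by
          rw [Finset.mul_sum]
          apply Finset.sum_congr rfl
          intro l _
          rw [Finset.mul_sum]
          apply Finset.sum_congr rfl
          intro q _
          rw [Finset.sum_const, Finset.card_univ, Fintype.card_fin, nsmul_eq_mul]
          field_simp
      _ ≤ ε / 2 * 1 := by
          have := tree_cost N j₀
          gcongr
      _ = ε / 2 := by ring
  have h2 : ∑ k : Fin N, |shiftV ε j₀ c Δ (Sum.inr (Sum.inl k))| ≤ ε / 3 := by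
    simp only [shiftV, apply_ite abs, abs_zero, abs_of_pos (show 0 < ε / 3 by positivity)]
    exact sum_unique_le _ _ (by positivity) hc
  have h3 : ∑ k : Fin N, |shiftV ε j₀ c Δ (Sum.inr (Sum.inr k))| ≤ ε / 6 := by
    simp only [shiftV, apply_ite abs, abs_zero, abs_of_pos (show 0 < ε / 6 by positivity)]
    exact sum_unique_le (fun k : Fin N => k.val = j₀) _ (by positivity)
      (fun n n' h h' => Fin.ext (h.trans h'.symm))
  linarith

lemma eta_shift {d N : ℕ} {ε : ℝ} (hε : 0 < ε) (hd : 1 ≤ d) (j₀ : ℕ) (hj₀ : 1 ≤ j₀) (hj₀N : j₀ < N)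
    (c : Fin N → Prop) (Δ : Fin d → ℤ) (z : Idx d N → ℝ) (j : ℕ) (hj : j < N) (i : Fin d) :
    eta ε (z + shiftV ε j₀ c Δ) j i = eta ε z j i + if j₀ < j then (Δ i : ℝ) else 0 := by
  have h : ∀ m ∈ nodes N j, wt d ε m.1.val m.2.val * (z + shiftV ε j₀ c Δ) (Sum.inl (m.1, m.2, i)) =
      wt d ε m.1.val m.2.val * z (Sum.inl (m.1, m.2, i)) +
        Δ i * (if m.2.val = j₀ / 2 ^ m.1.val then (1 : ℝ) else 0) := by
    intro m hm
    have hp := nodes_pos hm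
    have hw := wt_pos hε hd m.1.val m.2.val
    simp only [Pi.add_apply, shiftV, hp, and_true]
    split_ifs
    · field_simp
    · ring
  unfold eta
  rw [Finset.sum_congr rfl h, Finset.sum_add_distrib, ← Finset.mul_sum,
    nodes_count N j₀ j hj₀ hj₀N hj]
  simp

lemma mech_DP {d T : ℕ} {ε : ℝ} (hε : 0 < ε) (hd : 1 ≤ d) (τ : ℝ) :
    IsEventDP ε (mech (d := d) (T := T) ε τ) := by
  classical
  rintro x y ⟨t₀, hxy⟩ S hS
  unfold mech
  rw [Measure.map_apply (out_meas ε τ x) hS, Measure.map_apply (out_meas ε τ y) hS]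
  set Δ : Fin d → ℤ := fun i => ((x t₀ i).toNat : ℤ) - (y t₀ i).toNat with hΔdef
  have hΔ : ∀ i, |Δ i| ≤ 1 := by
    intro i
    simp only [Δ]
    cases x t₀ i <;> cases y t₀ i <;> simp
  have hH := H_diff x y t₀ hxy
  let traj : (Fin T → Fin d → Bool) → (Idx d (T + 2) → ℝ) → Fin (T + 1) → ℕ × ℕ :=
    fun x z n => stx ε τ x z n.val
  have htm : ∀ x, Measurable (traj x) := fun x => measurable_pi_lambda _ fun n => stx_meas ε τ x _
  let A : (Fin T → Fin d → Bool) → (Fin (T + 1) → ℕ × ℕ) → Set (Idx d (T + 2) → ℝ) :=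
    fun x p => (out ε τ x ⁻¹' S) ∩ (traj x ⁻¹' {p})
  have hAm : ∀ x p, MeasurableSet (A x p) := fun x p =>
    ((out_meas ε τ x) hS).inter ((htm x) (measurableSet_singleton p))
  have hstep : ∀ p, noise _ (A x p) ≤ ENNReal.ofReal (Real.exp ε) * noise _ (A y p) := by
    intro p
    by_cases hne : ∃ z₀, traj x z₀ = p
    swap
    · have : A x p = ∅ := by
        ext z
        simp only [A, Set.mem_inter_iff, Set.mem_preimage, Set.mem_singleton_iff,
          Set.mem_empty_iff_false, iff_false]
        rintro ⟨-, h⟩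
        exact hne ⟨z, h⟩
      rw [this]
      simp
    obtain ⟨z₀, hz₀⟩ := hne
    set j₀ := (stx ε τ x z₀ t₀.val).1 with hj₀
    have hb0 := st_bounds (H x) (nu ε z₀) (rho ε z₀) τ t₀.val
    change (stx ε τ x z₀ t₀.val).2 ≤ _ ∧ 1 ≤ j₀ ∧ j₀ ≤ _ at hb0
    let c : Fin (T + 2) → Prop := fun n => (stx ε τ x z₀ n.val).1 = j₀ ∧
      (stx ε τ x z₀ (n.val + 1)).1 = j₀ + 1
    have hc : ∀ n n', c n → c n' → n = n' := by
      have haux : ∀ n n', c n → c n' → ¬ n < n' := by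
        intro n n' h h' hlt
        have := st_mono (H x) (nu ε z₀) (rho ε z₀) τ (m := n.val + 1) (n := n'.val) hlt
        change stx ε τ x z₀ _ = stx ε τ x z₀ _ ∨ (stx ε τ x z₀ _).1 < (stx ε τ x z₀ _).1 ∧ _ at this
        have h1 := h.2
        have h2 := h'.1
        rcases this with h3 | h3
        · rw [h3] at h1; omega
        · omega
      intro n n' h h'
      rcases lt_trichotomy n n' with h1 | h1 | h1
      · exact absurd h1 (haux _ _ h h')
      · exact h1
      · exact absurd h1 (haux _ _ h' h)
    apply noise_shift (shiftV ε j₀ c Δ) ε (shiftV_cost hε hd j₀ c hc Δ hΔ) _ _ (hAm y p) (hAm x p)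
    rintro z ⟨hzS, hzp⟩
    have hzz : ∀ n ≤ T, stx ε τ x z n = stx ε τ x z₀ n := by
      intro n hn
      have : traj x z = traj x z₀ := by
        rw [hz₀]; exact hzp
      exact congrFun this ⟨n, by omega⟩
    have hst : ∀ n ≤ T, stx ε τ y (z + shiftV ε j₀ c Δ) n = stx ε τ x z n := by
      apply st_shift (H x) (H y) (nu ε z) (rho ε z) (nu ε (z + shiftV ε j₀ c Δ))
        (rho ε (z + shiftV ε j₀ c Δ)) τ t₀.val T Δ hΔ hH
      · intro j hj
        change _ = _ + if j = (stx ε τ x z t₀.val).1 then _ else _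
        rw [hzz t₀.val (by omega), ← hj₀]
        have : (Fin.ofNat (T + 2) j).val = j := by
          simp only [Fin.ofNat]; exact Nat.mod_eq_of_lt (by omega)
        simp only [rho, Pi.add_apply, shiftV, this]
        split_ifs
        · field_simp
        · ring
      · intro n hn
        change _ = _ + if (stx ε τ x z n).1 = (stx ε τ x z t₀.val).1 ∧
          (stx ε τ x z (n + 1)).1 = (stx ε τ x z t₀.val).1 + 1 then _ else _
        rw [hzz t₀.val (by omega), hzz n (by omega), hzz (n + 1) (by omega), ← hj₀]
        have : (Fin.ofNat (T + 2) n).val = n := by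
          simp only [Fin.ofNat]; exact Nat.mod_eq_of_lt (by omega)
        simp only [nu, Pi.add_apply, shiftV, c, this]
        split_ifs
        · field_simp; ring
        · ring
    refine ⟨?_, ?_⟩
    · have : out ε τ y (z + shiftV ε j₀ c Δ) = out ε τ x z := by
        funext t i
        have ht := t.2
        have hb := st_bounds (H x) (nu ε z) (rho ε z) τ (t.val + 1)
        change (stx ε τ x z (t.val + 1)).2 ≤ _ ∧ 1 ≤ (stx ε τ x z (t.val + 1)).1 ∧
          (stx ε τ x z (t.val + 1)).1 ≤ _ at hb
        simp only [out]
        rw [hst _ (by omega), eta_shift hε hd j₀ (by omega) (by omega) c Δ z _ (by omega) i]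
        have h1 := hH (stx ε τ x z (t.val + 1)).2 i
        have h1' : (H x (stx ε τ x z (t.val + 1)).2 i : ℝ) = H y (stx ε τ x z (t.val + 1)).2 i +
          if t₀.val < (stx ε τ x z (t.val + 1)).2 then (Δ i : ℝ) else 0 := by
          have := congrArg (Int.cast : ℤ → ℝ) h1
          push_cast at this
          simp only [this, Δ]
          push_cast
          rfl
        have hiff : t₀.val < (stx ε τ x z (t.val + 1)).2 ↔ j₀ < (stx ε τ x z (t.val + 1)).1 := by
          have e0 : j₀ = (stx ε τ x z t₀.val).1 := by rw [hzz _ (by omega)]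
          have hb1 := (st_bounds (H x) (nu ε z) (rho ε z) τ t₀.val).1
          change (stx ε τ x z _).2 ≤ _ at hb1
          rcases le_total t₀.val (t.val + 1) with hle | hle
          · have := st_mono (H x) (nu ε z) (rho ε z) τ hle
            change stx ε τ x z _ = stx ε τ x z _ ∨ (stx ε τ x z _).1 < (stx ε τ x z _).1 ∧ _ at this
            rcases this with h | h
            · rw [h] at e0 hb1
              omega
            · change _ ∧ _ < (stx ε τ x z (t.val + 1)).2 at h
              omega
          · have := st_mono (H x) (nu ε z) (rho ε z) τ hle
            change stx ε τ x z _ = stx ε τ x z _ ∨ (stx ε τ x z _).1 < (stx ε τ x z _).1 ∧ _ at this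
            rcases this with h | h
            · rw [h] at *
              omega
            · omega
        rw [h1']
        simp only [hiff]
        ring
      show out ε τ y (z + shiftV ε j₀ c Δ) ∈ S
      rw [this]
      exact hzS
    · show traj y (z + shiftV ε j₀ c Δ) = p
      rw [← hz₀]
      funext n
      have hn := n.2
      show stx ε τ y _ n.val = stx ε τ x z₀ n.val
      rw [hst _ (by omega), hzz _ (by omega)]
  calc noise _ (out ε τ x ⁻¹' S) ≤ noise _ (⋃ p, A x p) := by
        apply measure_mono
        intro z hz
        exact Set.mem_iUnion.2 ⟨traj x z, hz, rfl⟩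
    _ ≤ ∑' p, noise _ (A x p) := measure_iUnion_le _
    _ ≤ ∑' p, ENNReal.ofReal (Real.exp ε) * noise _ (A y p) := ENNReal.tsum_le_tsum hstep
    _ = ENNReal.ofReal (Real.exp ε) * noise _ (⋃ p, A y p) := by
        rw [ENNReal.tsum_mul_left, measure_iUnion _ (hAm y)]
        intro p p' hpp
        apply Set.disjoint_left.2
        rintro z ⟨-, h⟩ ⟨-, h'⟩
        exact hpp (h.symm.trans h')
    _ ≤ _ := by
        gcongr
        exact Set.iUnion_subset fun p => Set.inter_subset_left

end HCO

namespace HCO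

lemma noise_union {ι κ : Type*} [Fintype ι] [DecidableEq ι] [Fintype κ] (J : κ → Finset ι)
    (s : κ → ℝ) (c : κ → ℝ) (β : ℝ) (hc : ∀ k, 0 ≤ c k)
    (h : ∀ k, noise ι {z | s k < ∑ j ∈ J k, |z j|} ≤ ENNReal.ofReal (c k))
    (hβ : ∑ k, c k ≤ β) :
    ENNReal.ofReal (1 - β) ≤ noise ι {z | ∀ k, ∑ j ∈ J k, |z j| ≤ s k} := by
  have hm : MeasurableSet {z : ι → ℝ | ∀ k, ∑ j ∈ J k, |z j| ≤ s k} := by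
    have : {z : ι → ℝ | ∀ k, ∑ j ∈ J k, |z j| ≤ s k} = ⋂ k, {z | ∑ j ∈ J k, |z j| ≤ s k} := by
      ext z; simp
    rw [this]
    exact MeasurableSet.iInter fun k => measurableSet_le (by fun_prop) measurable_const
  have hbad : noise ι {z | ∀ k, ∑ j ∈ J k, |z j| ≤ s k}ᶜ ≤ ENNReal.ofReal β := by
    calc _ ≤ noise ι (⋃ k, {z | s k < ∑ j ∈ J k, |z j|}) := by
          apply measure_mono
          intro z hz
          simpa using hz
      _ ≤ ∑ k, noise ι {z | s k < ∑ j ∈ J k, |z j|} := measure_iUnion_fintype_le _ _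
      _ ≤ ∑ k, ENNReal.ofReal (c k) := Finset.sum_le_sum fun k _ => h k
      _ = ENNReal.ofReal (∑ k, c k) := (ENNReal.ofReal_sum_of_nonneg fun k _ => hc k).symm
      _ ≤ _ := ENNReal.ofReal_le_ofReal hβ
  have hβ0 : 0 ≤ β := (Finset.sum_nonneg fun k _ => hc k).trans hβ
  rw [ENNReal.ofReal_sub _ hβ0, ENNReal.ofReal_one, tsub_le_iff_right]
  have := prob_add_prob_compl (μ := noise ι) hm
  rw [← this]
  gcongr

/-- Tail level for the partition noise. -/
noncomputable def Lam (T : ℕ) (β : ℝ) : ℝ := 2 * Real.log (8 * ((T : ℝ) + 2) / β)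

/-- Tail level for the prefix noise. -/
noncomputable def Sj (d : ℕ) (β : ℝ) (j : ℕ) : ℝ :=
  2 * (2 * Nat.log 2 j * Real.log 2 + Real.log (2 * d * ((j : ℝ) + 1) * (j + 2) / β))

/-- Index set of the prefix noise. -/
def Jset (d N : ℕ) (j : ℕ) (i : Fin d) : Finset (Idx d N) :=
  (nodes N j).map ⟨fun m => Sum.inl (m.1, m.2, i), by
    intro m m' h
    simpa [Prod.ext_iff] using h⟩

lemma telescoping (N : ℕ) : ∑ j ∈ Finset.range N, 1 / (((j : ℝ) + 1) * (j + 2)) = 1 - 1 / ((N : ℝ) + 1) := by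
  induction N with
  | zero => simp
  | succ n ih =>
    rw [Finset.sum_range_succ, ih]
    push_cast
    field_simp
    ring

lemma good_event {d T : ℕ} (hd : 1 ≤ d) {β : ℝ} (hβ : 0 < β) :
    ENNReal.ofReal (1 - β) ≤ noise (Idx d (T + 2)) {z |
      (∀ a : Fin (T + 2) ⊕ Fin (T + 2), |z (Sum.inr a)| ≤ Lam T β) ∧
      ∀ (j : Fin (T + 2)) (i : Fin d), ∑ m ∈ nodes (T + 2) j.val, |z (Sum.inl (m.1, m.2, i))| ≤
        Sj d β j.val} := by
  have hd' : (0 : ℝ) < d := by exact_mod_cast hd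
  let κ := (Fin (T + 2) ⊕ Fin (T + 2)) ⊕ (Fin (T + 2) × Fin d)
  let J : κ → Finset (Idx d (T + 2)) := Sum.elim (fun a => {Sum.inr a}) (fun p => Jset d _ p.1.val p.2)
  let s : κ → ℝ := Sum.elim (fun _ => Lam T β) (fun p => Sj d β p.1.val)
  let c : κ → ℝ := Sum.elim (fun _ => β / (4 * ((T : ℝ) + 2)))
    (fun p => β / (2 * d) * (1 / (((p.1.val : ℝ) + 1) * (p.1.val + 2))))
  have hmain := noise_union J s c β ?_ ?_ ?_
  · refine hmain.trans (measure_mono ?_)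
    intro z hz
    refine ⟨fun a => ?_, fun j i => ?_⟩
    · simpa [J, s] using hz (Sum.inl a)
    · have h := hz (Sum.inr (j, i))
      simp only [J, s, Jset, Sum.elim_inr, Finset.sum_map] at h
      exact h
  · rintro (a | p)
    · simp only [c, Sum.elim_inl]; positivity
    · simp only [c, Sum.elim_inr]; positivity
  · rintro (a | p)
    · refine (noise_tail (J (Sum.inl a)) 1 (by simp [J]) _).trans (ENNReal.ofReal_le_ofReal ?_)
      simp only [s, c, Sum.elim_inl, Lam]
      rw [mul_div_cancel_left₀ _ (by norm_num : (2 : ℝ) ≠ 0), Real.exp_neg,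
        Real.exp_log (by positivity)]
      apply le_of_eq
      field_simp
      norm_num
    · refine (noise_tail (J (Sum.inr p)) (2 * Nat.log 2 p.1.val)
        (by simpa [J, Jset] using nodes_card _ _) _).trans (ENNReal.ofReal_le_ofReal ?_)
      simp only [s, c, Sum.elim_inr, Sj]
      rw [mul_div_cancel_left₀ _ (by norm_num : (2 : ℝ) ≠ 0), neg_add, Real.exp_add, Real.exp_neg,
        Real.exp_neg (Real.log _), Real.exp_log (by positivity)]
      have : Real.exp (2 * (Nat.log 2 p.1.val : ℝ) * Real.log 2) = 2 ^ (2 * Nat.log 2 p.1.val) := by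
        have h := Real.exp_nat_mul (Real.log 2) (2 * Nat.log 2 p.1.val)
        rw [Real.exp_log (by norm_num)] at h
        rw [← h]
        push_cast
        rfl
      rw [this]
      apply le_of_eq
      field_simp
  · rw [Fintype.sum_sum_type]
    simp only [c, Sum.elim_inl, Sum.elim_inr]
    have h1 : ∑ _a : Fin (T + 2) ⊕ Fin (T + 2), β / (4 * ((T : ℝ) + 2)) = β / 2 := by
      simp
      field_simp
      ring
    have h2 : ∑ p : Fin (T + 2) × Fin d, β / (2 * d) * (1 / (((p.1.val : ℝ) + 1) * (p.1.val + 2))) ≤ β / 2 := by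
      rw [Fintype.sum_prod_type]
      simp only [Finset.sum_const, Finset.card_univ, Fintype.card_fin, nsmul_eq_mul]
      rw [← Finset.mul_sum, ← Finset.mul_sum,
        Fin.sum_univ_eq_sum_range (fun j : ℕ => 1 / (((j : ℝ) + 1) * (j + 2))) (T + 2), telescoping]
      have h3 : (0 : ℝ) ≤ 1 / (((T + 2 : ℕ) : ℝ) + 1) := by positivity
      calc (d : ℝ) * (β / (2 * d) * (1 - 1 / (((T + 2 : ℕ) : ℝ) + 1))) ≤ d * (β / (2 * d) * 1) := by
            gcongr; linarith
        _ = β / 2 := by field_simp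
    linarith

lemma Lam_pos (T : ℕ) {β : ℝ} (hβ : 0 < β) (hβ1 : β < 1) : 0 < Lam T β := by
  unfold Lam
  have : 1 < 8 * ((T : ℝ) + 2) / β := by
    rw [lt_div_iff₀ hβ]
    have : (0 : ℝ) ≤ T := by positivity
    linarith
  have := Real.log_pos this
  linarith

section util
variable {d T : ℕ} {ε β : ℝ} (hε : 0 < ε) (hβ : 0 < β) (hβ1 : β < 1)
  (x : Fin T → Fin d → Bool) (z : Idx d (T + 2) → ℝ)
  (hz : ∀ a : Fin (T + 2) ⊕ Fin (T + 2), |z (Sum.inr a)| ≤ Lam T β)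

lemma nu_le (hε : 0 < ε) (hz : ∀ a : Fin (T + 2) ⊕ Fin (T + 2), |z (Sum.inr a)| ≤ Lam T β) (n : ℕ) :
    |nu ε z n| ≤ 6 / ε * Lam T β := by
  unfold nu
  rw [abs_mul, abs_of_pos (by positivity)]
  have := hz (Sum.inl (Fin.ofNat (T + 2) n))
  gcongr

lemma rho_le (hε : 0 < ε) (hz : ∀ a : Fin (T + 2) ⊕ Fin (T + 2), |z (Sum.inr a)| ≤ Lam T β) (n : ℕ) :
    |rho ε z n| ≤ 6 / ε * Lam T β := by
  unfold rho
  rw [abs_mul, abs_of_pos (by positivity)]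
  have := hz (Sum.inr (Fin.ofNat (T + 2) n))
  gcongr

include hε hβ hβ1 hz in
lemma seg_count (n : ℕ) : (stx ε (3 * (6 / ε * Lam T β)) x z n).1 ≤
    1 + ∑ i, H x (stx ε (3 * (6 / ε * Lam T β)) x z n).2 i := by
  induction n with
  | zero => simp [stx, st]
  | succ n ih =>
    have hcase := st_succ_cases (H x) (nu ε z) (rho ε z) (3 * (6 / ε * Lam T β)) n
    have hb := (st_bounds (H x) (nu ε z) (rho ε z) (3 * (6 / ε * Lam T β)) n).1
    unfold stx at ih ⊢
    rcases hcase with ⟨h, h'⟩ | ⟨h, -⟩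
    · rw [h]
      simp only
      have a1 := abs_le.1 (nu_le z hε hz n)
      have a2 := abs_le.1 (rho_le z hε hz (st (H x) (nu ε z) (rho ε z) (3 * (6 / ε * Lam T β)) n).1)
      have hL : 0 < 6 / ε * Lam T β := mul_pos (by positivity) (Lam_pos T hβ hβ1)
      have hD : (0 : ℝ) < D (H x) n (st (H x) (nu ε z) (rho ε z) (3 * (6 / ε * Lam T β)) n).2 := by
        linarith [a1.1, a1.2, a2.1, a2.2]
      have hD' : 0 < D (H x) n (st (H x) (nu ε z) (rho ε z) (3 * (6 / ε * Lam T β)) n).2 := by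
        exact_mod_cast hD
      unfold D at hD'
      rw [Finset.lt_sup_iff] at hD'
      obtain ⟨i, -, hi⟩ := hD'
      have : ∑ i, H x (st (H x) (nu ε z) (rho ε z) (3 * (6 / ε * Lam T β)) n).2 i <
          ∑ i, H x (n + 1) i := by
        apply Finset.sum_lt_sum
        · intro k _
          exact H_mono x (by omega) k
        · exact ⟨i, Finset.mem_univ _, by omega⟩
      omega
    · rw [h]; exact ih

include hε hβ hβ1 hz in
lemma seg_err (t : ℕ) (i : Fin d) : (H x (t + 1) i : ℝ) -
    H x (stx ε (3 * (6 / ε * Lam T β)) x z (t + 1)).2 i ≤ 5 * (6 / ε * Lam T β) := by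
  have hcase := st_succ_cases (H x) (nu ε z) (rho ε z) (3 * (6 / ε * Lam T β)) t
  have hL : 0 < 6 / ε * Lam T β := mul_pos (by positivity) (Lam_pos T hβ hβ1)
  unfold stx
  rcases hcase with ⟨h, h'⟩ | ⟨h, h'⟩
  · rw [h]
    simp only [sub_self]
    linarith
  · rw [h]
    have a1 := abs_le.1 (nu_le z hε hz t)
    have a2 := abs_le.1 (rho_le z hε hz (st (H x) (nu ε z) (rho ε z) (3 * (6 / ε * Lam T β)) t).1)
    have h1 : H x (t + 1) i - H x (st (H x) (nu ε z) (rho ε z) (3 * (6 / ε * Lam T β)) t).2 i ≤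
        D (H x) t (st (H x) (nu ε z) (rho ε z) (3 * (6 / ε * Lam T β)) t).2 :=
      Finset.le_sup (f := fun i => H x (t + 1) i -
        H x (st (H x) (nu ε z) (rho ε z) (3 * (6 / ε * Lam T β)) t).2 i) (Finset.mem_univ i)
    have h2 : (H x (t + 1) i : ℝ) ≤
        H x (st (H x) (nu ε z) (rho ε z) (3 * (6 / ε * Lam T β)) t).2 i +
        D (H x) t (st (H x) (nu ε z) (rho ε z) (3 * (6 / ε * Lam T β)) t).2 := by
      exact_mod_cast (by omega)
    linarith [a1.1, a1.2, a2.1, a2.2]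

end util

lemma eta_le {d N : ℕ} {ε : ℝ} (hε : 0 < ε) (hd : 1 ≤ d) (z : Idx d N → ℝ) (j : ℕ) (i : Fin d)
    (s : ℝ) (hs : ∑ m ∈ nodes N j, |z (Sum.inl (m.1, m.2, i))| ≤ s) :
    |eta ε z j i| ≤ 2 * d / ε * ((Nat.log 2 j : ℝ) + 1) * s := by
  unfold eta
  calc _ ≤ ∑ m ∈ nodes N j, |wt d ε m.1.val m.2.val * z (Sum.inl (m.1, m.2, i))| :=
        Finset.abs_sum_le_sum_abs _ _
    _ ≤ ∑ m ∈ nodes N j, 2 * d / ε * ((Nat.log 2 j : ℝ) + 1) * |z (Sum.inl (m.1, m.2, i))| := by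
        apply Finset.sum_le_sum
        intro m hm
        rw [abs_mul, abs_of_pos (wt_pos hε hd _ _)]
        have : ((m.1.val : ℝ) + Nat.log 2 m.2.val) ≤ Nat.log 2 j := by exact_mod_cast nodes_log hm
        unfold wt
        gcongr
    _ = 2 * d / ε * ((Nat.log 2 j : ℝ) + 1) * ∑ m ∈ nodes N j, |z (Sum.inl (m.1, m.2, i))| := by
        rw [Finset.mul_sum]
    _ ≤ _ := by gcongr

lemma log_le_logb {y : ℝ} (hy : 1 ≤ y) : Real.log y ≤ Real.logb 2 y := by
  unfold Real.logb
  rw [le_div_iff₀ (Real.log_pos (by norm_num))]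
  have h1 : Real.log 2 ≤ 1 := by linarith [Real.log_two_lt_d9]
  have h2 := Real.log_nonneg hy
  nlinarith

lemma one_le_log2c (z : ℝ) : 1 ≤ log2c z := by
  unfold log2c
  rw [Real.le_logb_iff_rpow_le (by norm_num) (by positivity)]
  simp

lemma logb_le_log2c {z : ℝ} (hz : 0 < z) : Real.logb 2 z ≤ log2c z := by
  unfold log2c
  exact Real.logb_le_logb_of_le (by norm_num) hz (le_max_left _ _)

lemma numeric_eta {d j : ℕ} {a β : ℝ} (hd : 1 ≤ d) (hda : (d : ℝ) ≤ a) (hβ : 0 < β) (hβ1 : β < 1)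
    (hj1 : 1 ≤ j) (hj : (j : ℝ) ≤ a + 1) :
    ((Nat.log 2 j : ℝ) + 1) * Sj d β j ≤ 78 * log2c (a / β) ^ 2 := by
  have hd' : (1 : ℝ) ≤ d := by exact_mod_cast hd
  have ha : 1 ≤ a := hd'.trans hda
  set L := log2c (a / β) with hL
  have hL1 : 1 ≤ L := one_le_log2c _
  have hab : Real.logb 2 a + Real.logb 2 (1 / β) ≤ L := by
    rw [← Real.logb_mul (by positivity) (by positivity), mul_one_div]
    exact logb_le_log2c (by positivity)
  have ha0 : 0 ≤ Real.logb 2 a := Real.logb_nonneg (by norm_num) ha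
  have hb0 : 0 ≤ Real.logb 2 (1 / β) := Real.logb_nonneg (by norm_num) (by
    rw [le_div_iff₀ hβ]; linarith)
  have hj1' : (1 : ℝ) ≤ j := by exact_mod_cast hj1
  have h1 : (Nat.log 2 j : ℝ) ≤ 2 * L := by
    have : (Nat.log 2 j : ℝ) ≤ Real.logb 2 j := by
      rw [Real.le_logb_iff_rpow_le (by norm_num) (by positivity), Real.rpow_natCast]
      exact_mod_cast Nat.pow_log_le_self 2 (by omega)
    have h2 : Real.logb 2 j ≤ Real.logb 2 (2 * a) :=
      Real.logb_le_logb_of_le (by norm_num) (by positivity) (by linarith)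
    rw [Real.logb_mul (by norm_num) (by positivity), Real.logb_self_eq_one (by norm_num)] at h2
    linarith
  have h2 : Real.log (2 * d * ((j : ℝ) + 1) * (j + 2) / β) ≤ 9 * L := by
    have hge : 1 ≤ 2 * d * ((j : ℝ) + 1) * (j + 2) / β := by
      rw [le_div_iff₀ hβ]
      have : (1 : ℝ) * 1 * 1 * 1 ≤ 2 * d * ((j : ℝ) + 1) * (j + 2) := by
        gcongr <;> linarith
      linarith
    have h3 : Real.logb 2 (2 * d * ((j : ℝ) + 1) * (j + 2) / β) ≤ Real.logb 2 (2 ^ 5 * a ^ 3 * (1 / β)) := by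
      apply Real.logb_le_logb_of_le (by norm_num) (by positivity)
      calc 2 * d * ((j : ℝ) + 1) * (j + 2) / β ≤ 2 * a * (4 * a) * (4 * a) / β := by
            gcongr <;> linarith
        _ = _ := by ring
    rw [Real.logb_mul (by positivity) (by positivity), Real.logb_mul (by positivity) (by positivity),
      Real.logb_pow, Real.logb_pow, Real.logb_self_eq_one (by norm_num)] at h3
    have := log_le_logb hge
    push_cast at h3
    linarith
  have h3 : Sj d β j ≤ 26 * L := by
    unfold Sj
    have hl2 : Real.log 2 ≤ 1 := by linarith [Real.log_two_lt_d9]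
    have hl0 : 0 ≤ Real.log 2 := Real.log_nonneg (by norm_num)
    have : (Nat.log 2 j : ℝ) * Real.log 2 ≤ 2 * L * 1 := by gcongr
    linarith
  calc _ ≤ ((Nat.log 2 j : ℝ) + 1) * (26 * L) := by gcongr
    _ ≤ (3 * L) * (26 * L) := by gcongr; linarith
    _ = _ := by ring

lemma numeric_lam {T : ℕ} {a β : ℝ} (hT : 1 ≤ T) (ha : 1 ≤ a) (hβ : 0 < β) (hβ1 : β < 1) :
    Lam T β ≤ 2 * (6 * log2c T + log2c (a / β)) := by
  have hT' : (1 : ℝ) ≤ T := by exact_mod_cast hT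
  unfold Lam
  have hge : 1 ≤ 8 * ((T : ℝ) + 2) / β := by
    rw [le_div_iff₀ hβ]; linarith
  have h1 := log_le_logb hge
  have h3 : Real.logb 2 (8 * ((T : ℝ) + 2) / β) ≤ Real.logb 2 (2 ^ 5 * T * (a / β)) := by
    apply Real.logb_le_logb_of_le (by norm_num) (by positivity)
    calc 8 * ((T : ℝ) + 2) / β ≤ (2 ^ 5 * T * a) / β := by
          apply div_le_div_of_nonneg_right _ hβ.le
          nlinarith
      _ = _ := by ring
  rw [Real.logb_mul (by positivity) (by positivity), Real.logb_mul (by positivity) (by positivity),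
      Real.logb_pow, Real.logb_self_eq_one (by norm_num)] at h3
  have h4 := logb_le_log2c (z := (T : ℝ)) (by positivity)
  have h5 := logb_le_log2c (z := a / β) (by positivity)
  have h6 := one_le_log2c (T : ℝ)
  push_cast at h3
  linarith

end HCO

theorem histogram_continual_observation :
    ∃ C : ℝ, 0 < C ∧
      ∀ (ε β : ℝ) (d T : ℕ) (_hε : 0 < ε) (_hβ : β ∈ Set.Ioo (0 : ℝ) 1)
        (_hd : 1 ≤ d) (hT : 1 ≤ T),
        ∃ M : (Fin T → Fin d → Bool) → Measure (Fin T → Fin d → ℝ),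
          IsCOMech M ∧ IsEventDP ε M ∧
          ∀ x, ENNReal.ofReal (1 - β) ≤
            M x {a | ∀ (t : Fin T) (i : Fin d),
              |a t i - (hist x t i : ℝ)| ≤
                C * ε⁻¹ * ((d : ℝ) *
                    (log2c ((d : ℝ) *
                      ((Finset.univ.sup fun j : Fin d => hist x (lastIdx T hT) j : ℕ) : ℝ)
                        / β)) ^ 2
                  + log2c (T : ℝ))} := by
  refine ⟨1000, by norm_num, ?_⟩
  intro ε β d T hε hβ hd hT
  obtain ⟨hβ0, hβ1⟩ := hβ
  refine ⟨HCO.mech ε (3 * (6 / ε * HCO.Lam T β)), HCO.mech_CO _ _, HCO.mech_DP hε hd _, fun x => ?_⟩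
  unfold HCO.mech
  refine le_trans ?_ (Measure.le_map_apply (HCO.out_meas _ _ x).aemeasurable _)
  refine (HCO.good_event hd hβ0).trans (measure_mono ?_)
  rintro z ⟨hz1, hz2⟩
  intro t i
  have ht := t.2
  set n := Finset.univ.sup fun j : Fin d => hist x (lastIdx T hT) j with hn
  have hHn : ∀ m ≤ T, ∀ i, HCO.H x m i ≤ n := by
    intro m hm i
    have h1 : hist x (lastIdx T hT) i ≤ n :=
      Finset.le_sup (f := fun j : Fin d => hist x (lastIdx T hT) j) (Finset.mem_univ i)
    rw [HCO.hist_eq] at h1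
    refine (HCO.H_mono x ?_ i).trans h1
    simp only [lastIdx]
    omega
  set τ := 3 * (6 / ε * HCO.Lam T β) with hτ
  have hcount := HCO.seg_count hε hβ0 hβ1 x z hz1 (t.val + 1)
  have herr := HCO.seg_err hε hβ0 hβ1 x z hz1 t.val i
  have hb := HCO.st_bounds (HCO.H x) (HCO.nu ε z) (HCO.rho ε z) τ (t.val + 1)
  change (HCO.stx ε τ x z (t.val + 1)).2 ≤ _ ∧ 1 ≤ (HCO.stx ε τ x z (t.val + 1)).1 ∧
          (HCO.stx ε τ x z (t.val + 1)).1 ≤ _ at hb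
  rw [← hτ] at hcount herr
  rw [HCO.hist_eq]
  simp only [HCO.out]
  have hmono := HCO.H_mono x hb.1 i
  generalize HCO.stx ε τ x z (t.val + 1) = p at *
  obtain ⟨j, s⟩ := p
  simp only at *
  have hsum : ∑ i, HCO.H x s i ≤ d * n := by
    calc _ ≤ ∑ _i : Fin d, n := Finset.sum_le_sum fun i _ => hHn s (by omega) i
      _ = d * n := by simp
  have heta := HCO.eta_le hε hd z j i _ (hz2 ⟨j, by omega⟩ i)
  have hd' : (1 : ℝ) ≤ d := by exact_mod_cast hd
  have hLT := HCO.one_le_log2c (T : ℝ)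
  rcases Nat.eq_zero_or_pos n with h0 | hpos
  · have hj : j = 1 := by rw [h0] at hsum; omega
    have e1 : HCO.H x s i = 0 := by have := hHn s (by omega) i; omega
    have e2 : HCO.H x (t.val + 1) i = 0 := by have := hHn (t.val + 1) (by omega) i; omega
    have e3 : HCO.eta ε z j i = 0 := by
      rw [hj]
      simp [HCO.eta, HCO.nodes]
    rw [e1, e2, e3]
    simp only [Nat.cast_zero, add_zero, sub_zero, abs_zero]
    positivity
  · have hn1 : (1 : ℝ) ≤ n := by exact_mod_cast hpos
    have hda : (d : ℝ) ≤ d * n := by nlinarith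
    have hj : (j : ℝ) ≤ (d : ℝ) * n + 1 := by
      have : j ≤ d * n + 1 := by omega
      exact_mod_cast this
    have k1 := HCO.numeric_eta hd hda hβ0 hβ1 hb.2.1 hj
    have k2 := HCO.numeric_lam (a := (d : ℝ) * n) hT (by linarith) hβ0 hβ1
    have hL := HCO.one_le_log2c ((d : ℝ) * n / β)
    set L := log2c ((d : ℝ) * n / β)
    have hmono' : (HCO.H x s i : ℝ) ≤ HCO.H x (t.val + 1) i := by exact_mod_cast hmono
    have q1 : |HCO.eta ε z j i| ≤ ε⁻¹ * (156 * (d * L ^ 2)) := by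
      refine heta.trans ?_
      calc _ = 2 * d / ε * (((Nat.log 2 j : ℝ) + 1) * HCO.Sj d β j) := by ring
        _ ≤ 2 * d / ε * (78 * L ^ 2) := by gcongr
        _ = _ := by ring
    have q2 : 5 * (6 / ε * HCO.Lam T β) ≤ ε⁻¹ * (360 * log2c T + 60 * (d * L ^ 2)) := by
      calc 5 * (6 / ε * HCO.Lam T β) ≤ 5 * (6 / ε * (2 * (6 * log2c T + L))) := by gcongr
        _ = ε⁻¹ * (360 * log2c T + 60 * L) := by ring
        _ ≤ _ := by
          gcongr
          nlinarith
    have q3 : ε⁻¹ * (156 * (d * L ^ 2)) + ε⁻¹ * (360 * log2c T + 60 * (d * L ^ 2)) ≤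
        1000 * ε⁻¹ * (d * L ^ 2 + log2c T) := by
      have hi : 0 < ε⁻¹ := by positivity
      have : 156 * (d * L ^ 2) + (360 * log2c T + 60 * (d * L ^ 2)) ≤
        1000 * (d * L ^ 2 + log2c T) := by
        have : 0 ≤ d * L ^ 2 := by positivity
        linarith
      calc _ = ε⁻¹ * (156 * (d * L ^ 2) + (360 * log2c T + 60 * (d * L ^ 2))) := by ring
        _ ≤ ε⁻¹ * (1000 * (d * L ^ 2 + log2c T)) := by gcongr
        _ = _ := by ring
    have q4 := abs_le.1 q1
    have q5 := abs_nonneg (HCO.eta ε z j i)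
    rw [abs_le]
    constructor <;> linarith [q4.1, q4.2]
end

section
/- There is a universal constant C > 0 such that for every ε > 0, β ∈ (0,1), and integers d, T ≥ 1, there exists an ε-differentially private (event level) continual-observation mechanism M with input universe {0,1}^d, output space ℝ and stream length T such that for every input stream x, with M(x)-probability at least 1 − β, the output sequence (a^1,…,a^T) satisfies |a^t − max_{i ≤ d} h^t(x)_i| ≤ C · ε^{-1} · ( d·log²(d·n_max(x)/β) + log T ) for all t ≤ T, where n_max(x) = max_{i ≤ d} h^T(x)_i (the MaxSum problem under continual observation). -/
open MeasureTheory

lemma gsum (r : ℝ) (h0 : 0 ≤ r) (h1 : r < 1) :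
    HasSum (fun z : ℤ => r ^ z.natAbs) ((1 + r) / (1 - r)) := by
  have hg := hasSum_geometric_of_lt_one h0 h1
  have h := HasSum.of_nat_of_neg_add_one (f := fun z : ℤ => r ^ z.natAbs)
    (m := (1 - r)⁻¹) (m' := r * (1 - r)⁻¹) (by simpa using hg) (by
      have := hg.mul_left r
      have e : (fun n : ℕ => r ^ (-((n:ℤ) + 1)).natAbs) = fun i => r * r ^ i := by
        funext n
        rw [← pow_succ']
        congr 1
      show HasSum (fun n : ℕ => r ^ (-((n:ℤ) + 1)).natAbs) _
      rw [e]; exact this)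
  convert h using 1
  rw [div_eq_mul_inv]; ring

/-- Two-sided geometric noise with parameter p. -/
noncomputable def gw (p : ℝ) (z : ℤ) : ℝ :=
  (1 - Real.exp (-p)) / (1 + Real.exp (-p)) * Real.exp (-p) ^ z.natAbs

noncomputable def gm (p : {p : ℝ // 0 < p}) : Measure ℤ :=
  Measure.count.withDensity (fun z => ENNReal.ofReal (gw p z))

lemma gw_pos (p : {p : ℝ // 0 < p}) (z : ℤ) : 0 < gw p z := by
  unfold gw
  have : Real.exp (-p.1) < 1 := by simpa using p.2
  have := Real.exp_pos (-p.1)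
  have : 0 < 1 - Real.exp (-p.1) := by linarith
  positivity

lemma gm_singleton (p : {p : ℝ // 0 < p}) (z : ℤ) : gm p {z} = ENNReal.ofReal (gw p z) := by
  simp [gm]

lemma gm_lintegral (p : {p : ℝ // 0 < p}) (f : ℤ → ENNReal) :
    ∫⁻ z, f z ∂(gm p) = ∑' z, f z * ENNReal.ofReal (gw p z) := by
  rw [lintegral_countable']
  simp [gm_singleton]

instance (p : {p : ℝ // 0 < p}) : IsProbabilityMeasure (gm p) := by
  constructor
  have h := gm_lintegral p 1
  simp only [Pi.one_apply, lintegral_one, one_mul] at h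
  rw [h]
  have h1 : Real.exp (-p.1) < 1 := by simpa using p.2
  have h0 := Real.exp_pos (-p.1)
  have hs : HasSum (gw p) 1 := by
    have := (gsum _ h0.le h1).mul_left ((1 - Real.exp (-p.1)) / (1 + Real.exp (-p.1)))
    have h3 : 1 - Real.exp (-p.1) ≠ 0 := by linarith
    have h4 : (1 - Real.exp (-p.1)) / (1 + Real.exp (-p.1)) *
        ((1 + Real.exp (-p.1)) / (1 - Real.exp (-p.1))) = 1 := by field_simp
    rw [h4] at this
    exact this
  rw [← ENNReal.ofReal_tsum_of_nonneg (fun z => (gw_pos p z).le) hs.summable, hs.tsum_eq]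
  simp

lemma gm_moment (p : {p : ℝ // 0 < p}) (q : ℝ) (hq : q ≤ p.1 / 2) :
    ∫⁻ z, ENNReal.ofReal (Real.exp (q * |(z:ℝ)|)) ∂(gm p) ≤ 2 := by
  rw [gm_lintegral]
  have h1 : Real.exp (-p.1 / 2) < 1 := by
    rw [Real.exp_lt_one_iff]; linarith [p.2]
  have h0 := Real.exp_pos (-p.1 / 2)
  set r := Real.exp (-p.1 / 2) with hr
  have hr2 : Real.exp (-p.1) = r ^ 2 := by
    rw [hr, ← Real.exp_nat_mul]; congr 1; push_cast; ring
  have hs := (gsum r h0.le h1).mul_left ((1 - r ^ 2) / (1 + r ^ 2))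
  have hc : 0 ≤ (1 - r ^ 2) / (1 + r ^ 2) := by
    have : 0 ≤ 1 - r ^ 2 := by nlinarith
    positivity
  calc _ ≤ ∑' z : ℤ, ENNReal.ofReal ((1 - r ^ 2) / (1 + r ^ 2) * r ^ z.natAbs) := by
        refine ENNReal.tsum_le_tsum fun z => ?_
        rw [← ENNReal.ofReal_mul (Real.exp_pos _).le]
        apply ENNReal.ofReal_le_ofReal
        unfold gw
        rw [hr2]
        have hz : |(z:ℝ)| = (z.natAbs : ℝ) := by
          rw [Nat.cast_natAbs]; simp
        have : Real.exp (q * |(z:ℝ)|) * (r ^ 2) ^ z.natAbs ≤ r ^ z.natAbs := by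
          rw [hz, hr, ← pow_mul, ← Real.exp_nat_mul, ← Real.exp_nat_mul, ← Real.exp_add]
          apply Real.exp_le_exp.2
          push_cast
          nlinarith [(Nat.cast_nonneg z.natAbs : (0:ℝ) ≤ _)]
        calc _ = (1 - r ^ 2) / (1 + r ^ 2) * (Real.exp (q * |(z:ℝ)|) * (r ^ 2) ^ z.natAbs) := by ring
          _ ≤ _ := by gcongr
    _ = ENNReal.ofReal ((1 - r ^ 2) / (1 + r ^ 2) * ((1 + r) / (1 - r))) := by
        rw [← ENNReal.ofReal_tsum_of_nonneg (fun z => by positivity) hs.summable, hs.tsum_eq]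
    _ ≤ ENNReal.ofReal 2 := by
        apply ENNReal.ofReal_le_ofReal
        rw [div_mul_div_comm, div_le_iff₀ (by nlinarith [sq_nonneg r])]
        nlinarith [sq_nonneg (1 - r), mul_nonneg (sub_nonneg.2 h1.le) (sq_nonneg (1 - r))]
    _ = 2 := by simp

lemma gw_shift (p : {p : ℝ // 0 < p}) (z s : ℤ) :
    gw p z ≤ Real.exp (p.1 * |(s:ℝ)|) * gw p (z + s) := by
  unfold gw
  have h1 : Real.exp (-p.1) < 1 := by simpa using p.2
  have h0 := Real.exp_pos (-p.1)
  have h2 : 0 ≤ (1 - Real.exp (-p.1)) / (1 + Real.exp (-p.1)) :=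
    div_nonneg (by linarith) (by linarith)
  have : Real.exp (-p.1) ^ z.natAbs ≤ Real.exp (p.1 * |(s:ℝ)|) * Real.exp (-p.1) ^ (z+s).natAbs := by
    rw [← Real.exp_nat_mul, ← Real.exp_nat_mul, ← Real.exp_add]
    apply Real.exp_le_exp.2
    have e1 : ((z.natAbs : ℕ) : ℝ) = |(z:ℝ)| := by rw [Nat.cast_natAbs]; simp
    have e2 : (((z+s).natAbs : ℕ) : ℝ) = |(z:ℝ)+s| := by rw [Nat.cast_natAbs]; simp
    rw [e1, e2]
    have := abs_add_le (z:ℝ) s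
    nlinarith [p.2]
  calc _ ≤ _ := mul_le_mul_of_nonneg_left this h2
    _ = _ := by ring

lemma pi_tail {ι : Type} [Fintype ι] (p : ι → {p : ℝ // 0 < p}) (J : Finset ι) (q : ℝ) (hq : 0 < q)
    (hJ : ∀ j ∈ J, q ≤ (p j).1) (δ : ℝ) (hδ : 0 < δ) :
    Measure.pi (fun j => gm (p j))
      {ω | 2 / q * (J.card * Real.log 2 + Real.log (1 / δ)) < ∑ j ∈ J, |(ω j : ℝ)|}
      ≤ ENNReal.ofReal δ := by
  classical
  have hind := ProbabilityTheory.iIndepFun_pi (μ := fun j => gm (p j))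
    (X := fun j (z : ℤ) => ENNReal.ofReal (Real.exp (q / 2 * |(z:ℝ)|)))
    (fun i => (measurable_of_countable _).aemeasurable)
  have hprod := ProbabilityTheory.lintegral_prod_eq_prod_lintegral_of_indepFun J
    (fun j (ω : ι → ℤ) => ENNReal.ofReal (Real.exp (q / 2 * |(ω j:ℝ)|))) hind
    (fun i => (measurable_of_countable _))
  have hle : ∏ j ∈ J, ∫⁻ ω, ENNReal.ofReal (Real.exp (q / 2 * |(ω j:ℝ)|))
      ∂(Measure.pi (fun j => gm (p j))) ≤ 2 ^ J.card := by
    rw [← Finset.prod_const]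
    refine Finset.prod_le_prod' fun j hj => ?_
    rw [(measurePreserving_eval (fun j => gm (p j)) j).lintegral_comp
      (f := fun z : ℤ => ENNReal.ofReal (Real.exp (q / 2 * |(z:ℝ)|))) (measurable_of_countable _)]
    exact gm_moment _ _ (by linarith [hJ j hj])
  rw [← hprod] at hle
  have hm := mul_meas_ge_le_lintegral (μ := Measure.pi (fun j => gm (p j)))
    (f := fun ω : ι → ℤ => ∏ j ∈ J, ENNReal.ofReal (Real.exp (q / 2 * |(ω j:ℝ)|)))
    (measurable_of_countable _) (ENNReal.ofReal (2 ^ J.card / δ))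
  have hpos : (0:ℝ) < 2 ^ J.card / δ := by positivity
  have hsub : {ω : ι → ℤ | 2 / q * (J.card * Real.log 2 + Real.log (1 / δ)) < ∑ j ∈ J, |(ω j : ℝ)|}
      ⊆ {ω | ENNReal.ofReal (2 ^ J.card / δ) ≤
          ∏ j ∈ J, ENNReal.ofReal (Real.exp (q / 2 * |(ω j:ℝ)|))} := by
    intro ω hω
    simp only [Set.mem_ofPred_eq] at hω ⊢
    rw [← ENNReal.ofReal_prod_of_nonneg (fun _ _ => (Real.exp_pos _).le), ← Real.exp_sum,
      ← Finset.mul_sum]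
    apply ENNReal.ofReal_le_ofReal
    rw [← Real.log_le_iff_le_exp hpos, Real.log_div (by positivity) hδ.ne', Real.log_pow]
    rw [one_div, Real.log_inv] at hω
    have := mul_lt_mul_of_pos_left hω (half_pos hq)
    have e : q / 2 * (2 / q * (J.card * Real.log 2 + -Real.log δ)) =
      J.card * Real.log 2 + -Real.log δ := by field_simp
    linarith
  refine (measure_mono hsub).trans ?_
  have hm2 := hm.trans hle
  have h2 : (2:ENNReal) ^ J.card = ENNReal.ofReal (2 ^ J.card / δ) * ENNReal.ofReal δ := by
    rw [← ENNReal.ofReal_mul hpos.le, div_mul_cancel₀ _ hδ.ne', ENNReal.ofReal_pow (by norm_num)]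
    simp
  rw [h2] at hm2
  exact (ENNReal.mul_le_mul_iff_right (by simpa using hpos) ENNReal.ofReal_ne_top).1 hm2

lemma pi_dp {ι : Type} [Fintype ι] (p : ι → {p : ℝ // 0 < p}) {O : Type} [MeasurableSpace O]
    (F G : (ι → ℤ) → O) (sh : (ι → ℤ) → ι → ℤ)
    (hF : ∀ ω, G (ω + sh ω) = F ω) (hinj : Function.Injective (fun ω => ω + sh ω)) (ε : ℝ)
    (hc : ∀ ω, ∑ j, (p j).1 * |(sh ω j : ℝ)| ≤ ε) (S : Set O) (hS : MeasurableSet S) :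
    (Measure.pi (fun j => gm (p j))).map F S ≤
      ENNReal.ofReal (Real.exp ε) * (Measure.pi (fun j => gm (p j))).map G S := by
  classical
  set μ := Measure.pi (fun j => gm (p j)) with hμ
  have mF : Measurable F := measurable_of_countable _
  have mG : Measurable G := measurable_of_countable _
  rw [Measure.map_apply mF hS, Measure.map_apply mG hS]
  rw [← μ.tsum_indicator_apply_singleton _ (mF hS), ← μ.tsum_indicator_apply_singleton _ (mG hS)]
  rw [← ENNReal.tsum_mul_left]
  refine le_trans ?_ (ENNReal.tsum_comp_le_tsum_of_injective hinj _)
  refine ENNReal.tsum_le_tsum fun ω => ?_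
  simp only [Set.indicator_apply, Set.mem_preimage, hF]
  split_ifs
  · rw [hμ, Measure.pi_singleton, Measure.pi_singleton]
    simp only [gm_singleton]
    rw [← ENNReal.ofReal_prod_of_nonneg (fun i _ => (gw_pos _ _).le),
      ← ENNReal.ofReal_prod_of_nonneg (fun i _ => (gw_pos _ _).le),
      ← ENNReal.ofReal_mul (Real.exp_pos _).le]
    apply ENNReal.ofReal_le_ofReal
    calc _ ≤ ∏ j, (Real.exp ((p j).1 * |(sh ω j : ℝ)|) * gw (p j) ((ω + sh ω) j)) :=
          Finset.prod_le_prod (fun i _ => (gw_pos _ _).le) (fun i _ => gw_shift _ _ _)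
      _ = Real.exp (∑ j, (p j).1 * |(sh ω j : ℝ)|) * ∏ j, gw (p j) ((ω + sh ω) j) := by
          rw [Finset.prod_mul_distrib, Real.exp_sum]
      _ ≤ _ := mul_le_mul_of_nonneg_right (Real.exp_le_exp.2 (hc ω))
          (Finset.prod_nonneg fun i _ => (gw_pos _ _).le)
  · simp

/-- Maximum coordinate. -/
def mx {d : ℕ} [NeZero d] (v : Fin d → ℤ) : ℤ := Finset.univ.sup' Finset.univ_nonempty v

lemma le_mx {d : ℕ} [NeZero d] (v : Fin d → ℤ) (i : Fin d) : v i ≤ mx v :=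
  Finset.le_sup' v (Finset.mem_univ i)

lemma exists_mx {d : ℕ} [NeZero d] (v : Fin d → ℤ) : ∃ i, mx v = v i := by
  obtain ⟨i, _, h⟩ := Finset.exists_mem_eq_sup' Finset.univ_nonempty v
  exact ⟨i, h⟩

lemma mx_le_add {d : ℕ} [NeZero d] (v w : Fin d → ℤ) (B : ℝ) (h : ∀ i, (v i : ℝ) ≤ w i + B) :
    (mx v : ℝ) ≤ mx w + B := by
  obtain ⟨i, hi⟩ := exists_mx v
  have h1 : ((w i : ℤ) : ℝ) ≤ mx w := by exact_mod_cast le_mx w i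
  rw [hi]; linarith [h i]

/-- The run of the segmenting algorithm: state is (current segment, current output). -/
noncomputable def run {d : ℕ} [NeZero d] (θ : ℕ → ℝ) (H N : ℕ → Fin d → ℤ) (ρ ν : ℕ → ℤ) : ℕ → ℕ × ℤ
  | 0 => (1, 0)
  | t + 1 =>
    let s := run θ H N ρ ν t
    open Classical in
    if θ s.1 + ρ s.1 < mx (H (t + 1) + N s.1) - s.2 + ν t then
      (s.1 + 1, mx (H (t + 1) + N (s.1 + 1)))
    else s

section
variable {d : ℕ} [NeZero d] (θ : ℕ → ℝ) (H N : ℕ → Fin d → ℤ) (ρ ν : ℕ → ℤ)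

lemma run_succ (t : ℕ) : run θ H N ρ ν (t + 1) =
    open Classical in
    if θ (run θ H N ρ ν t).1 + ρ (run θ H N ρ ν t).1 <
        mx (H (t + 1) + N (run θ H N ρ ν t).1) - (run θ H N ρ ν t).2 + ν t then
      ((run θ H N ρ ν t).1 + 1, mx (H (t + 1) + N ((run θ H N ρ ν t).1 + 1)))
    else run θ H N ρ ν t := rfl

lemma run_mono : Monotone (fun t => (run θ H N ρ ν t).1) := by
  refine monotone_nat_of_le_succ fun t => ?_
  rw [run_succ]; split_ifs <;> simp

lemma run_pos (t : ℕ) : 1 ≤ (run θ H N ρ ν t).1 :=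
  run_mono θ H N ρ ν (Nat.zero_le t)

lemma run_le (t : ℕ) : (run θ H N ρ ν t).1 ≤ t + 1 := by
  induction t with
  | zero => simp [run]
  | succ t ih =>
    rw [run_succ]; split_ifs
    · show _ + 1 ≤ _; omega
    · omega

lemma run_congr (H' : ℕ → Fin d → ℤ) (t : ℕ) (h : ∀ s ≤ t, H s = H' s) :
    run θ H N ρ ν t = run θ H' N ρ ν t := by
  induction t with
  | zero => rfl
  | succ t ih =>
    rw [run_succ, run_succ, ih (fun s hs => h s (by omega)), h (t+1) le_rfl]

/-- Closing time of the segment that contains t₀. -/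
def closes (r : ℕ → ℕ × ℤ) (t₀ t : ℕ) : Prop :=
  t₀ ≤ t ∧ (r t).1 = (r t₀).1 ∧ (r (t+1)).1 ≠ (r t₀).1

lemma run_align (H' N' : ℕ → Fin d → ℤ) (ρ' ν' : ℕ → ℤ) (t₀ : ℕ) (δ : Fin d → ℤ)
    (hδ : ∀ i, |δ i| ≤ 1)
    (hH1 : ∀ t ≤ t₀, H' t = H t) (hH2 : ∀ t, t₀ < t → H' t = H t - δ)
    (hN1 : ∀ k ≤ (run θ H N ρ ν t₀).1, N' k = N k)
    (hN2 : ∀ k, (run θ H N ρ ν t₀).1 < k → N' k = N k + δ)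
    (hρ : ∀ k, ρ' k = ρ k + open Classical in if k = (run θ H N ρ ν t₀).1 then 1 else 0)
    (T t : ℕ) (htT : t ≤ T)
    (hν : ∀ t < T, ν' t = ν t + open Classical in if closes (run θ H N ρ ν) t₀ t then 2 else 0) :
    run θ H' N' ρ' ν' t = run θ H N ρ ν t := by
  classical
  induction t with
  | zero => rfl
  | succ t ih =>
    have hm := run_mono θ H N ρ ν
    have hrs := run_succ θ H N ρ ν t
    replace ih := ih (by omega)
    replace hν := hν t (by omega)
    rw [run_succ θ H' N' ρ' ν', ih]
    set r := run θ H N ρ ν with hr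
    have hδ' : ∀ i, -1 ≤ (δ i : ℝ) ∧ (δ i : ℝ) ≤ 1 := fun i => by
      have := abs_le.1 (hδ i); exact ⟨by exact_mod_cast this.1, by exact_mod_cast this.2⟩
    rcases lt_or_ge t t₀ with ht | ht
    · have hnc : ¬ closes r t₀ t := fun h => by have := h.1; omega
      have hk : (r t).1 ≤ (r t₀).1 := hm ht.le
      have hk' : (r (t+1)).1 ≤ (r t₀).1 := hm (show t + 1 ≤ t₀ from ht)
      rw [hν, if_neg hnc, hN1 _ hk, hH1 (t+1) ht, hρ]
      rcases hk.lt_or_eq with hk2 | hk2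
      · rw [if_neg hk2.ne, hN1 _ hk2]
        rw [hrs]; simp
      · have : ¬ (θ (r t).1 + ρ (r t).1 < mx (H (t + 1) + N (r t).1) - (r t).2 + ν t) := by
          intro hc
          rw [if_pos hc] at hrs
          rw [hrs] at hk'
          simp at hk'; omega
        rw [hrs, if_neg this, if_neg]
        rw [if_pos hk2]; push_cast; push Not at this ⊢; linarith
    · have hk : (r t₀).1 ≤ (r t).1 := hm ht
      have hHt := hH2 (t+1) (by omega)
      have e2 : ∀ k, (r t₀).1 < k → H' (t+1) + N' k = H (t+1) + N k := fun k hk => by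
        rw [hHt, hN2 k hk]; abel
      rcases hk.lt_or_eq with hk2 | hk2
      · have hnc : ¬ closes r t₀ t := fun h => by have := h.2.1; omega
        rw [hν, if_neg hnc, hρ, if_neg hk2.ne', e2 _ hk2, e2 _ (by omega), hrs]
        simp
      · rw [e2 ((r t).1 + 1) (by omega), hHt, hN1 _ hk2.ge, hν, hρ, if_pos hk2.symm]
        have b1 := mx_le_add (H (t+1) + N (r t).1) (H (t+1) - δ + N (r t).1) 1 (fun i => by
          simp only [Pi.add_apply, Pi.sub_apply]; push_cast; linarith [hδ' i])
        have b2 := mx_le_add (H (t+1) - δ + N (r t).1) (H (t+1) + N (r t).1) 1 (fun i => by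
          simp only [Pi.add_apply, Pi.sub_apply]; push_cast; linarith [hδ' i])
        by_cases hc : θ (r t).1 + ρ (r t).1 < mx (H (t + 1) + N (r t).1) - (r t).2 + ν t
        · rw [if_pos hc] at hrs
          have : closes r t₀ t := ⟨ht, hk2.symm, by rw [hrs]; simp; omega⟩
          rw [if_pos this, hrs, if_pos]
          push_cast; linarith
        · rw [if_neg hc] at hrs
          have : ¬ closes r t₀ t := fun h => h.2.2 (by rw [hrs]; exact hk2.symm)
          rw [if_neg this, hrs, if_neg]
          push_cast; push Not at hc ⊢; linarith

lemma closes_unique (t₀ t t' : ℕ) (h : closes (run θ H N ρ ν) t₀ t)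
    (h' : closes (run θ H N ρ ν) t₀ t') : t = t' := by
  have hm := run_mono θ H N ρ ν
  wlog hlt : t < t' generalizing t t'
  · rcases lt_trichotomy t t' with h1 | h1 | h1
    · exact absurd h1 hlt
    · exact h1
    · exact (this t' t h' h h1).symm
  exfalso
  have h1 : (run θ H N ρ ν t₀).1 ≤ (run θ H N ρ ν (t+1)).1 := hm (by have := h.1; omega)
  have h2 : (run θ H N ρ ν (t+1)).1 ≤ (run θ H N ρ ν t').1 := hm (show t + 1 ≤ t' from hlt)
  have := h.2.2
  have := h'.2.1
  omega

/-- Deterministic accuracy. -/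
lemma run_acc (A : ℝ) (R : ℕ → ℝ) (H0 : H 0 = 0) (N1 : N 1 = 0) (Hm : Monotone H) (t : ℕ)
    (hθ : ∀ k, θ k = A + R k) (hν : ∀ s < t, |(ν s : ℝ)| ≤ A)
    (hA : 0 ≤ A) (hR : ∀ k, 0 ≤ R k)
    (hρ : ∀ k, 1 ≤ k → k ≤ t + 1 → |(ρ k : ℝ)| ≤ R k) :
    ∃ s ≤ t, (run θ H N ρ ν t).2 = mx (H s + N (run θ H N ρ ν t).1) ∧
      (((run θ H N ρ ν t).1 : ℤ) ≤ 1 + ∑ i, H s i) ∧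
      (mx (H t + N (run θ H N ρ ν t).1) - (run θ H N ρ ν t).2 : ℝ) ≤
        2 * A + 2 * R (run θ H N ρ ν t).1 := by
  classical
  induction t with
  | zero =>
    refine ⟨0, le_rfl, ?_, ?_, ?_⟩
    · simp [run, H0, N1, mx]
    · simp [run, H0]
    · have := hR 1
      simp [run, H0, N1, mx]
      linarith
  | succ t ih =>
    obtain ⟨s, hs, h1, h2, h3⟩ := ih (fun s hs => hν s (by omega)) (fun k hk hk' => hρ k hk (by omega))
    have hp := run_pos θ H N ρ ν t
    have hl := run_le θ H N ρ ν t
    rw [run_succ]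
    set r := run θ H N ρ ν with hr
    have a1 := abs_le.1 (hν t (by omega))
    have a2 := abs_le.1 (hρ (r t).1 hp (by omega))
    have a3 := hθ (r t).1
    split_ifs with hc
    · refine ⟨t+1, le_rfl, rfl, ?_, ?_⟩
      · have hlt : mx (H s + N (r t).1) < mx (H (t+1) + N (r t).1) := by
          have : ((r t).2 : ℝ) < mx (H (t+1) + N (r t).1) := by linarith
          rw [← h1]; exact_mod_cast this
        obtain ⟨i, hi⟩ := exists_mx (H (t+1) + N (r t).1)
        have hi2 : H s i < H (t+1) i := by
          have := le_mx (H s + N (r t).1) i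
          simp only [Pi.add_apply] at this hi
          omega
        have : ∑ i, H s i < ∑ i, H (t+1) i :=
          Finset.sum_lt_sum (fun j _ => Hm (show s ≤ t + 1 by omega) j) ⟨i, Finset.mem_univ _, hi2⟩
        push_cast; omega
      · have := hR ((r t).1 + 1)
        simp; linarith
    · push Not at hc
      exact ⟨s, by omega, h1, h2, by linarith⟩
end

/-- Tree nodes (level, index) summed up in the prefix of segments 1, ..., k-1. -/
def nodes (k : ℕ) : Finset (ℕ × ℕ) :=
  (Finset.range (Nat.log 2 k)).image (fun l => (l, 1)) ∪
  ((Finset.range (Nat.log 2 k)).filter (fun l => k / 2 ^ l % 2 = 1)).image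
    (fun l => (l, k / 2 ^ l - 1))

lemma two_le_div {k l : ℕ} (h : l < Nat.log 2 k) : 2 ≤ k / 2 ^ l := by
  rw [Nat.le_div_iff_mul_le (by positivity)]
  have hk : k ≠ 0 := by rintro rfl; simp at h
  have := Nat.pow_log_le_self 2 hk
  have h2 : 2 ^ (l+1) ≤ 2 ^ Nat.log 2 k := Nat.pow_le_pow_right (by norm_num) h
  rw [pow_succ] at h2; omega

lemma nodes_sum {M : Type*} [AddCommMonoid M] (k : ℕ) (f : ℕ × ℕ → M) :
    ∑ n ∈ nodes k, f n = ∑ l ∈ Finset.range (Nat.log 2 k),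
      (f (l, 1) + if k / 2 ^ l % 2 = 1 then f (l, k / 2 ^ l - 1) else 0) := by
  unfold nodes
  rw [Finset.sum_union, Finset.sum_image, Finset.sum_image, Finset.sum_filter, Finset.sum_add_distrib]
  · intro a _ b _ h; simpa using (Prod.ext_iff.1 h).1
  · intro a _ b _ h; simpa using (Prod.ext_iff.1 h).1
  · rw [Finset.disjoint_left]
    intro n h1 h2
    simp only [Finset.mem_image, Finset.mem_filter, Finset.mem_range] at h1 h2
    obtain ⟨l, hl, rfl⟩ := h1
    obtain ⟨l', ⟨hl', ho⟩, h⟩ := h2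
    have := (Prod.ext_iff.1 h).2
    have := two_le_div hl'
    simp only at *
    omega

lemma nodes_card (k : ℕ) : (nodes k).card ≤ 2 * Nat.log 2 k := by
  unfold nodes
  refine (Finset.card_union_le _ _).trans ?_
  have h1 := Finset.card_image_le (s := Finset.range (Nat.log 2 k)) (f := fun l => (l, 1))
  have h2 := Finset.card_image_le
    (s := (Finset.range (Nat.log 2 k)).filter (fun l => k / 2 ^ l % 2 = 1))
    (f := fun l => (l, k / 2 ^ l - 1))
  have h3 := Finset.card_filter_le (Finset.range (Nat.log 2 k)) (fun l => k / 2 ^ l % 2 = 1)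
  simp only [Finset.card_range] at *
  omega

lemma nodes_mem {k : ℕ} {n : ℕ × ℕ} (h : n ∈ nodes k) :
    n.1 < Nat.log 2 k ∧ 1 ≤ n.2 ∧ n.2 < k ∧ n.2 * 2 ^ n.1 ≤ k := by
  simp only [nodes, Finset.mem_union, Finset.mem_image, Finset.mem_filter, Finset.mem_range] at h
  have key : ∀ l < Nat.log 2 k, ∀ a, 1 ≤ a → a < k / 2 ^ l → a < k ∧ a * 2 ^ l ≤ k := by
    intro l hl a ha h
    have := Nat.div_le_self k (2 ^ l)
    refine ⟨by omega, ?_⟩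
    exact (Nat.le_div_iff_mul_le (by positivity)).1 h.le
  rcases h with ⟨l, hl, rfl⟩ | ⟨l, ⟨hl, ho⟩, rfl⟩
  · exact ⟨hl, le_rfl, key l hl 1 le_rfl (two_le_div hl)⟩
  · have := two_le_div hl
    exact ⟨hl, by simp only; omega, key l hl _ (by omega) (by omega)⟩

lemma count_id (k j : ℕ) : (∑ l ∈ Finset.range (Nat.log 2 k),
      ((if j / 2 ^ l = 1 then 1 else 0) +
        if k / 2 ^ l % 2 = 1 then (if j / 2 ^ l = k / 2 ^ l - 1 then 1 else 0) else 0))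
    = if 1 ≤ j ∧ j < k then (1:ℤ) else 0 := by
  induction k using Nat.strong_induction_on generalizing j with
  | _ k ih =>
    rcases lt_or_ge k 2 with hk | hk
    · rw [Nat.log_of_lt hk, if_neg (by omega)]; simp
    · rw [Nat.log_of_one_lt_of_le (by norm_num) hk, Finset.sum_range_succ']
      have := ih (k / 2) (by omega) (j / 2)
      simp only [Nat.div_div_eq_div_mul, ← pow_succ'] at this
      rw [this]
      simp only [pow_zero, Nat.div_one]
      split_ifs <;> omega

lemma nodes_count (k j : ℕ) (hj : 1 ≤ j) (c : ℤ) :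
    ∑ n ∈ nodes k, (if n.2 ≠ 0 ∧ j / 2 ^ n.1 = n.2 then c else 0) = if j < k then c else 0 := by
  have h := count_id k j
  rw [← Finset.sum_congr rfl (g := fun l => ((if j / 2 ^ l = 1 then 1 else 0) +
        if k / 2 ^ l % 2 = 1 then (if j / 2 ^ l = k / 2 ^ l - 1 then 1 else 0) else 0)) (fun l _ => rfl),
    ← nodes_sum k (fun n => if j / 2 ^ n.1 = n.2 then (1:ℤ) else 0)] at h
  have e : ∑ n ∈ nodes k, (if n.2 ≠ 0 ∧ j / 2 ^ n.1 = n.2 then c else 0) =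
      c * ∑ n ∈ nodes k, (if j / 2 ^ n.1 = n.2 then (1:ℤ) else 0) := by
    rw [Finset.mul_sum]
    refine Finset.sum_congr rfl fun n hn => ?_
    have := (nodes_mem hn).2.1
    by_cases h : j / 2 ^ n.1 = n.2
    · rw [if_pos ⟨by omega, h⟩, if_pos h, mul_one]
    · rw [if_neg (fun h' => h h'.2), if_neg h, mul_zero]
  rw [e, h]
  simp [hj]

abbrev Ix (d T : ℕ) := ((Fin (T+1) × Fin (T+1)) × Fin d) ⊕ (Fin (T+2) ⊕ Fin T)

/-- Noise of a tree node. -/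
def Zl {d T : ℕ} (ω : Ix d T → ℤ) (n : ℕ × ℕ) (i : Fin d) : ℤ :=
  if h : n.1 < T + 1 ∧ n.2 < T + 1 then ω (Sum.inl ((⟨n.1, h.1⟩, ⟨n.2, h.2⟩), i)) else 0

def Nl {d T : ℕ} (ω : Ix d T → ℤ) (k : ℕ) (i : Fin d) : ℤ := ∑ n ∈ nodes k, Zl ω n i

def rl {d T : ℕ} (ω : Ix d T → ℤ) (k : ℕ) : ℤ :=
  if h : k < T + 2 then ω (Sum.inr (Sum.inl ⟨k, h⟩)) else 0

def nl {d T : ℕ} (ω : Ix d T → ℤ) (t : ℕ) : ℤ :=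
  if h : t < T then ω (Sum.inr (Sum.inr ⟨t, h⟩)) else 0

def Hx {d T : ℕ} (x : Fin T → Fin d → Bool) (t : ℕ) (i : Fin d) : ℤ :=
  ∑ s : Fin T, if s.1 < t ∧ x s i then 1 else 0

/-- Privacy parameters. -/
noncomputable def pr (ε : ℝ) (d T : ℕ) : Ix d T → ℝ
  | Sum.inl ((l, a), _) => ε / (2 * d * (Nat.log 2 (a.1 * 2 ^ l.1) + 1))
  | Sum.inr (Sum.inl _) => ε / 4
  | Sum.inr (Sum.inr _) => ε / 8

/-- Alignment shift. -/
noncomputable def shf {d T : ℕ} (r : ℕ → ℕ × ℤ) (t₀ : ℕ) (δ : Fin d → ℤ) : Ix d T → ℤ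
  | Sum.inl ((l, a), i) => if a.1 ≠ 0 ∧ (r t₀).1 / 2 ^ l.1 = a.1 then δ i else 0
  | Sum.inr (Sum.inl k) => if k.1 = (r t₀).1 then 1 else 0
  | Sum.inr (Sum.inr t) => open Classical in if closes r t₀ t.1 then 2 else 0

noncomputable abbrev rn {d T : ℕ} [NeZero d] (θ : ℕ → ℝ) (x : Fin T → Fin d → Bool)
    (ω : Ix d T → ℤ) : ℕ → ℕ × ℤ := run θ (Hx x) (Nl ω) (rl ω) (nl ω)

lemma pr_pos (ε : ℝ) (hε : 0 < ε) (d T : ℕ) (hd : 1 ≤ d) (j : Ix d T) : 0 < pr ε d T j := by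
  have : (0:ℝ) < d := by exact_mod_cast hd
  rcases j with ⟨⟨l, a⟩, i⟩ | k | t <;> simp only [pr] <;> positivity

lemma Zl_shift {d T : ℕ} (ω : Ix d T → ℤ) (r : ℕ → ℕ × ℤ) (t₀ : ℕ) (δ : Fin d → ℤ)
    (hk : (r t₀).1 ≤ T) (n : ℕ × ℕ) (i : Fin d) :
    Zl (ω + shf r t₀ δ) n i = Zl ω n i +
      if n.2 ≠ 0 ∧ (r t₀).1 / 2 ^ n.1 = n.2 then δ i else 0 := by
  unfold Zl
  by_cases h : n.1 < T + 1 ∧ n.2 < T + 1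
  · rw [dif_pos h, dif_pos h]; rfl
  · rw [dif_neg h, dif_neg h, if_neg]; · rfl
    rintro ⟨h1, h2⟩
    apply h
    have h3 : 2 ^ n.1 ≤ (r t₀).1 := by
      by_contra hc
      rw [Nat.div_eq_of_lt (by omega)] at h2
      omega
    have h4 : n.1 < 2 ^ n.1 := Nat.lt_two_pow_self
    have := Nat.div_le_self (r t₀).1 (2 ^ n.1)
    omega

lemma rl_shift {d T : ℕ} (ω : Ix d T → ℤ) (r : ℕ → ℕ × ℤ) (t₀ : ℕ) (δ : Fin d → ℤ)
    (hk : (r t₀).1 ≤ T) (k : ℕ) :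
    rl (ω + shf r t₀ δ) k = rl ω k + if k = (r t₀).1 then 1 else 0 := by
  unfold rl
  by_cases h : k < T + 2
  · rw [dif_pos h, dif_pos h]; rfl
  · rw [dif_neg h, dif_neg h, if_neg (by omega)]; rfl

lemma rn_align {d T : ℕ} [NeZero d] (θ : ℕ → ℝ) (x y : Fin T → Fin d → Bool) (t₀ : Fin T)
    (hxy : ∀ s, s ≠ t₀ → x s = y s) (ω : Ix d T → ℤ) (t : ℕ) (ht : t ≤ T) :
    rn θ y (ω + shf (rn θ x ω) t₀ (fun i => (if x t₀ i then 1 else 0) - (if y t₀ i then 1 else 0))) t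
      = rn θ x ω t := by
  have hk1 : 1 ≤ (rn θ x ω t₀).1 := run_pos θ (Hx x) (Nl ω) (rl ω) (nl ω) t₀
  have hk2 : (rn θ x ω t₀).1 ≤ t₀ + 1 := run_le θ (Hx x) (Nl ω) (rl ω) (nl ω) t₀
  have hT := t₀.2
  set δ : Fin d → ℤ := (fun i => (if x t₀ i then 1 else 0) - (if y t₀ i then 1 else 0)) with hδ
  have hN : ∀ k i, Nl (ω + shf (rn θ x ω) t₀ δ) k i = Nl ω k i +
      if (rn θ x ω t₀).1 < k then δ i else 0 := by
    intro k i
    unfold Nl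
    rw [Finset.sum_congr rfl (fun n _ => Zl_shift ω (rn θ x ω) t₀ δ (by omega) n i),
      Finset.sum_add_distrib, nodes_count _ _ hk1]
  refine run_align θ (Hx x) (Nl ω) (rl ω) (nl ω) (Hx y) _ _ _ t₀ δ ?_ ?_ ?_ ?_ ?_ ?_ T t ht ?_
  · intro i; simp only [hδ]; split_ifs <;> simp
  · intro t ht; funext i
    refine Finset.sum_congr rfl fun s _ => ?_
    by_cases h : s = t₀
    · subst h; rw [if_neg (by omega), if_neg (by omega)]
    · rw [hxy s h]
  · intro t ht; funext i
    simp only [Pi.sub_apply, Hx]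
    rw [eq_sub_iff_add_eq, ← Finset.add_sum_erase _ _ (Finset.mem_univ t₀),
      ← Finset.add_sum_erase _ (fun s : Fin T => if s.1 < t ∧ x s i then (1:ℤ) else 0) (Finset.mem_univ t₀)]
    have : ∑ s ∈ Finset.univ.erase t₀, (if s.1 < t ∧ y s i then (1:ℤ) else 0) =
        ∑ s ∈ Finset.univ.erase t₀, (if s.1 < t ∧ x s i then (1:ℤ) else 0) :=
      Finset.sum_congr rfl fun s hs => by rw [hxy s (Finset.ne_of_mem_erase hs)]
    rw [this]
    simp only [ht, true_and, hδ]; ring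
  · intro k hk; funext i; rw [hN, if_neg (by simpa using hk), add_zero]
  · intro k hk; funext i; rw [hN, if_pos hk]; rfl
  · intro k
    rw [rl_shift _ _ _ _ (by omega)]
  · intro s hs
    unfold nl
    rw [dif_pos hs, dif_pos hs]
    simp only [Pi.add_apply, shf]; rfl

lemma rn_inj {d T : ℕ} [NeZero d] (θ : ℕ → ℝ) (x y : Fin T → Fin d → Bool) (t₀ : Fin T)
    (hxy : ∀ s, s ≠ t₀ → x s = y s) : Function.Injective (fun ω : Ix d T → ℤ =>
      ω + shf (rn θ x ω) t₀ (fun i => (if x t₀ i then 1 else 0) - (if y t₀ i then 1 else 0))) := by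
  intro ω ω' h
  simp only at h
  have hr : ∀ t ≤ T, rn θ x ω t = rn θ x ω' t := fun t ht => by
    rw [← rn_align θ x y t₀ hxy ω t ht, h, rn_align θ x y t₀ hxy ω' t ht]
  have hs : ∀ δ : Fin d → ℤ, (shf (rn θ x ω) t₀ δ : Ix d T → ℤ) = shf (rn θ x ω') t₀ δ := by
    intro δ
    funext j
    have h0 := hr t₀ t₀.2.le
    rcases j with ⟨⟨l, a⟩, i⟩ | k | t
    · simp only [shf, h0]
    · simp only [shf, h0]
    · have : closes (rn θ x ω) t₀ t.1 ↔ closes (rn θ x ω') t₀ t.1 := by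
        unfold closes
        rw [h0, hr t t.2.le, hr (t+1) t.2]
      simp only [shf]
      by_cases hc : closes (rn θ x ω) t₀ t.1
      · rw [if_pos hc, if_pos (this.1 hc)]
      · rw [if_neg hc, if_neg (fun h => hc (this.2 h))]
  rw [hs] at h
  exact add_right_cancel h

lemma sh_cost {d T : ℕ} [NeZero d] (ε : ℝ) (hε : 0 < ε) (θ : ℕ → ℝ) (x : Fin T → Fin d → Bool)
    (t₀ : Fin T) (δ : Fin d → ℤ) (hδ : ∀ i, |δ i| ≤ 1) (ω : Ix d T → ℤ) :
    ∑ j, pr ε d T j * |((shf (rn θ x ω) t₀ δ : Ix d T → ℤ) j : ℝ)| ≤ ε := by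
  classical
  have hk1 := run_pos θ (Hx x) (Nl ω) (rl ω) (nl ω) t₀
  have hu := closes_unique θ (Hx x) (Nl ω) (rl ω) (nl ω) t₀
  have hd : (0:ℝ) < d := by exact_mod_cast Nat.pos_of_ne_zero (NeZero.ne d)
  rw [Fintype.sum_sum_type, Fintype.sum_sum_type]
  set k0 := (rn θ x ω t₀).1 with hk0
  have c2 : ∑ k : Fin (T+2), pr ε d T (Sum.inr (Sum.inl k)) *
      |((shf (rn θ x ω) t₀ δ : Ix d T → ℤ) (Sum.inr (Sum.inl k)) : ℝ)| ≤ ε / 4 := by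
    calc _ ≤ ∑ k : Fin (T+2), if k.1 = k0 then ε / 4 else 0 := by
          refine Finset.sum_le_sum fun k _ => ?_
          simp only [shf, pr, ← hk0]
          split_ifs <;> simp
      _ ≤ _ := by
          rw [← Finset.sum_filter, Finset.sum_const, nsmul_eq_mul]
          have : (Finset.univ.filter (fun k : Fin (T+2) => k.1 = k0)).card ≤ 1 :=
            Finset.card_le_one.2 fun a ha b hb => by
              simp at ha hb; exact Fin.ext (by omega)
          have : ((Finset.univ.filter (fun k : Fin (T+2) => k.1 = k0)).card : ℝ) ≤ 1 := by
            exact_mod_cast this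
          nlinarith
  have c3 : ∑ t : Fin T, pr ε d T (Sum.inr (Sum.inr t)) *
      |((shf (rn θ x ω) t₀ δ : Ix d T → ℤ) (Sum.inr (Sum.inr t)) : ℝ)| ≤ ε / 4 := by
    calc _ ≤ ∑ t : Fin T, if closes (rn θ x ω) t₀ t.1 then ε / 4 else 0 := by
          refine Finset.sum_le_sum fun k _ => ?_
          simp only [shf, pr]
          split_ifs
          · push_cast; rw [abs_of_pos (by norm_num)]; linarith
          · simp
      _ ≤ _ := by
          rw [← Finset.sum_filter, Finset.sum_const, nsmul_eq_mul]
          have : (Finset.univ.filter (fun t : Fin T => closes (rn θ x ω) t₀ t.1)).card ≤ 1 :=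
            Finset.card_le_one.2 fun a ha b hb => by
              simp only [Finset.mem_filter, Finset.mem_univ, true_and] at ha hb
              exact Fin.ext (hu _ _ ha hb)
          have : ((Finset.univ.filter (fun t : Fin T => closes (rn θ x ω) t₀ t.1)).card : ℝ) ≤ 1 := by
            exact_mod_cast this
          nlinarith
  have c1 : ∑ j : (Fin (T+1) × Fin (T+1)) × Fin d, pr ε d T (Sum.inl j) *
      |((shf (rn θ x ω) t₀ δ : Ix d T → ℤ) (Sum.inl j) : ℝ)| ≤ ε / 2 := by
    set e := Nat.log 2 k0 with he
    calc _ ≤ ∑ j : (Fin (T+1) × Fin (T+1)) × Fin d,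
          (if j.1.2.1 ≠ 0 ∧ k0 / 2 ^ j.1.1.1 = j.1.2.1 then ε / (2 * d * (e + 1)) else 0) := by
          refine Finset.sum_le_sum fun j _ => ?_
          obtain ⟨⟨l, a⟩, i⟩ := j
          simp only [shf, pr, ← hk0]
          split_ifs with h
          · have hl : Nat.log 2 (a.1 * 2 ^ l.1) = e := by
              have h1 : 2 ^ l.1 ≤ k0 := by
                by_contra hc
                rw [Nat.div_eq_of_lt (by omega)] at h
                omega
              have h2 := Nat.div_mul_le_self k0 (2 ^ l.1)
              rw [h.2] at h2
              apply le_antisymm (Nat.log_mono_right h2)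
              apply Nat.le_log_of_pow_le (by norm_num)
              have h3 : l.1 ≤ Nat.log 2 k0 := Nat.le_log_of_pow_le (by norm_num) h1
              obtain ⟨m, hm⟩ := Nat.exists_eq_add_of_le h3
              have h4 := Nat.pow_log_le_self 2 (show k0 ≠ 0 by omega)
              rw [hm, pow_add, mul_comm] at h4 ⊢
              rw [← h.2]
              exact Nat.mul_le_mul_right _ ((Nat.le_div_iff_mul_le (by positivity)).2 h4)
            rw [hl]
            have : |((δ i : ℤ) : ℝ)| ≤ 1 := by exact_mod_cast hδ i
            exact mul_le_of_le_one_right (by positivity) this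
          · simp
      _ ≤ _ := by
          rw [← Finset.sum_filter, Finset.sum_const, nsmul_eq_mul]
          have hc : (Finset.univ.filter (fun j : (Fin (T+1) × Fin (T+1)) × Fin d =>
              j.1.2.1 ≠ 0 ∧ k0 / 2 ^ j.1.1.1 = j.1.2.1)).card ≤ (e + 1) * d := by
            have := Finset.card_le_card_of_injOn
              (s := Finset.univ.filter (fun j : (Fin (T+1) × Fin (T+1)) × Fin d =>
              j.1.2.1 ≠ 0 ∧ k0 / 2 ^ j.1.1.1 = j.1.2.1))
              (t := Finset.range (e+1) ×ˢ (Finset.univ : Finset (Fin d)))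
              (fun j => (j.1.1.1, j.2)) (by
                intro j hj
                simp only [Finset.coe_filter, Finset.mem_univ, true_and, Set.mem_ofPred_eq] at hj
                simp only [Finset.coe_product, Set.mem_prod, Finset.mem_coe, Finset.mem_range,
                  Finset.mem_univ, and_true]
                have h1 : 2 ^ j.1.1.1 ≤ k0 := by
                  by_contra hc
                  rw [Nat.div_eq_of_lt (by omega)] at hj
                  omega
                have := Nat.le_log_of_pow_le (b := 2) (by norm_num) h1
                omega) (by
                rintro ⟨⟨l, a⟩, i⟩ hj ⟨⟨l', a'⟩, i'⟩ hj' h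
                simp only [Finset.coe_filter, Finset.mem_univ, true_and, Set.mem_ofPred_eq,
                  Prod.mk.injEq] at hj hj' h ⊢
                refine ⟨⟨Fin.ext h.1, Fin.ext ?_⟩, h.2⟩
                rw [← hj.2, ← hj'.2, h.1])
            simpa using this
          have hc' : ((Finset.univ.filter (fun j : (Fin (T+1) × Fin (T+1)) × Fin d =>
              j.1.2.1 ≠ 0 ∧ k0 / 2 ^ j.1.1.1 = j.1.2.1)).card : ℝ) ≤ (e + 1) * d := by
            exact_mod_cast hc
          refine (mul_le_mul_of_nonneg_right hc' (by positivity)).trans (le_of_eq ?_)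
          field_simp
  linarith

/-- Noise bounds. -/
noncomputable def bA (ε β : ℝ) (T : ℕ) : ℝ := 2 / (ε / 8) * (1 * Real.log 2 + Real.log (1 / (β / (3 * T))))

noncomputable def bR (ε β : ℝ) (k : ℕ) : ℝ :=
  2 / (ε / 4) * (1 * Real.log 2 + Real.log (1 / (β / 3 * (1 / ((k + 1) * (k + 2))))))

noncomputable def bB (ε β : ℝ) (d k : ℕ) : ℝ :=
  2 / (ε / (2 * d * (Nat.log 2 k + 1))) * (2 * Nat.log 2 k * Real.log 2 +
    Real.log (1 / (β / 3 * (1 / ((k + 1) * (k + 2))) / d)))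

lemma tele (m : ℕ) : ∑ k ∈ Finset.range m, (1 / (((k:ℝ) + 1) * (k + 2))) ≤ 1 := by
  have : ∑ k ∈ Finset.range m, (1 / (((k:ℝ) + 1) * (k + 2))) = 1 - 1 / (m + 1) := by
    induction m with
    | zero => simp
    | succ m ih =>
      rw [Finset.sum_range_succ, ih]
      push_cast
      field_simp
      ring
  rw [this]
  have : (0:ℝ) ≤ 1 / (m + 1) := by positivity
  linarith

noncomputable def prs (ε : ℝ) (hε : 0 < ε) (d T : ℕ) (hd : 1 ≤ d) (j : Ix d T) : {p : ℝ // 0 < p} :=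
  ⟨pr ε d T j, pr_pos ε hε d T hd j⟩

lemma tail_node {d T : ℕ} (ε : ℝ) (hε : 0 < ε) (hd : 1 ≤ d) (k : ℕ) (hk1 : 1 ≤ k) (hk : k ≤ T + 1)
    (i : Fin d) (δ : ℝ) (hδ : 0 < δ) :
    Measure.pi (fun j => gm (prs ε hε d T hd j))
      {ω | 2 / (ε / (2 * d * (Nat.log 2 k + 1))) * (2 * Nat.log 2 k * Real.log 2 + Real.log (1 / δ))
        < |(Nl ω k i : ℝ)|} ≤ ENNReal.ofReal δ := by
  classical
  have hd' : (0:ℝ) < d := by exact_mod_cast hd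
  set emb : ℕ × ℕ → Ix d T := fun n => Sum.inl ((Fin.ofNat (T+1) n.1, Fin.ofNat (T+1) n.2), i) with hemb
  have hlog : Nat.log 2 k < k := Nat.log_lt_self 2 (by omega)
  have hin : ∀ n ∈ nodes k, n.1 < T + 1 ∧ n.2 < T + 1 := fun n hn => by
    have := nodes_mem hn; omega
  have hinj : Set.InjOn emb (nodes k) := by
    intro n hn m hm h
    simp only [hemb, Sum.inl.injEq, Prod.mk.injEq, and_true, Fin.ext_iff, Fin.val_ofNat] at h
    rw [Nat.mod_eq_of_lt (hin n hn).1, Nat.mod_eq_of_lt (hin n hn).2,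
      Nat.mod_eq_of_lt (hin m hm).1, Nat.mod_eq_of_lt (hin m hm).2] at h
    exact Prod.ext h.1 h.2
  have hZ : ∀ (ω : Ix d T → ℤ), ∀ n ∈ nodes k, Zl ω n i = ω (emb n) := fun ω n hn => by
    unfold Zl
    rw [dif_pos (hin n hn)]
    simp only [hemb]
    congr 4 <;> (apply Fin.ext; simp [Nat.mod_eq_of_lt (hin n hn).1, Nat.mod_eq_of_lt (hin n hn).2])
  have hq : 0 < ε / (2 * d * ((Nat.log 2 k : ℝ) + 1)) := by positivity
  refine (measure_mono ?_).trans (pi_tail (prs ε hε d T hd) ((nodes k).image emb)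
    (ε / (2 * d * ((Nat.log 2 k : ℝ) + 1))) hq ?_ δ hδ)
  · intro ω hω
    simp only [Set.mem_ofPred_eq] at hω ⊢
    rw [Finset.sum_image hinj]
    have h1 : |(Nl ω k i : ℝ)| ≤ ∑ n ∈ nodes k, |(ω (emb n) : ℝ)| := by
      unfold Nl
      push_cast
      refine (Finset.abs_sum_le_sum_abs _ _).trans (le_of_eq ?_)
      exact Finset.sum_congr rfl fun n hn => by rw [hZ ω n hn]
    have h2 : ((((nodes k).image emb).card : ℕ) : ℝ) ≤ 2 * Nat.log 2 k := by
      exact_mod_cast Finset.card_image_le.trans (nodes_card k)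
    refine lt_of_le_of_lt ?_ (hω.trans_le h1)
    have := Real.log_nonneg (show (1:ℝ) ≤ 2 by norm_num)
    gcongr
  · intro j hj
    obtain ⟨n, hn, rfl⟩ := Finset.mem_image.1 hj
    have hm := nodes_mem hn
    simp only [prs, pr, hemb, Fin.val_ofNat, Nat.mod_eq_of_lt (hin n hn).1, Nat.mod_eq_of_lt (hin n hn).2]
    have : Nat.log 2 (n.2 * 2 ^ n.1) ≤ Nat.log 2 k := Nat.log_mono_right hm.2.2.2
    gcongr

lemma tail_one {d T : ℕ} (ε : ℝ) (hε : 0 < ε) (hd : 1 ≤ d) (j : Ix d T) (q : ℝ) (hq : 0 < q)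
    (hj : q ≤ pr ε d T j) (δ : ℝ) (hδ : 0 < δ) :
    Measure.pi (fun j => gm (prs ε hε d T hd j))
      {ω | 2 / q * (1 * Real.log 2 + Real.log (1 / δ)) < |(ω j : ℝ)|} ≤ ENNReal.ofReal δ := by
  have := pi_tail (prs ε hε d T hd) {j} q hq (by simpa [prs] using hj) δ hδ
  simpa using this

lemma tailA {d T : ℕ} (ε β : ℝ) (hε : 0 < ε) (hβ : 0 < β) (hd : 1 ≤ d) (hT : 1 ≤ T) (s : Fin T) :
    Measure.pi (fun j => gm (prs ε hε d T hd j))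
      {ω | bA ε β T < |(ω (Sum.inr (Sum.inr s)) : ℝ)|} ≤ ENNReal.ofReal (β / (3 * T)) := by
  have hT' : (0:ℝ) < T := by exact_mod_cast hT
  unfold bA
  exact tail_one ε hε hd (Sum.inr (Sum.inr s)) (ε / 8) (by positivity) (by simp [pr]) _ (by positivity)

lemma tailR {d T : ℕ} (ε β : ℝ) (hε : 0 < ε) (hβ : 0 < β) (hd : 1 ≤ d) (k : Fin (T+2)) :
    Measure.pi (fun j => gm (prs ε hε d T hd j))
      {ω | bR ε β k.1 < |(ω (Sum.inr (Sum.inl k)) : ℝ)|} ≤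
      ENNReal.ofReal (β / 3 * (1 / ((k.1 + 1) * (k.1 + 2)))) := by
  unfold bR
  exact tail_one ε hε hd (Sum.inr (Sum.inl k)) (ε / 4) (by positivity) (by simp [pr]) _ (by positivity)

lemma tailB {d T : ℕ} (ε β : ℝ) (hε : 0 < ε) (hβ : 0 < β) (hd : 1 ≤ d) (k : ℕ) (hk1 : 1 ≤ k)
    (hk : k ≤ T + 1) (i : Fin d) :
    Measure.pi (fun j => gm (prs ε hε d T hd j))
      {ω | bB ε β d k < |(Nl ω k i : ℝ)|} ≤
      ENNReal.ofReal (β / 3 * (1 / ((k + 1) * (k + 2))) / d) := by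
  have hd' : (0:ℝ) < d := by exact_mod_cast hd
  unfold bB
  exact tail_node ε hε hd k hk1 hk i _ (by positivity)

def goodSet (ε β : ℝ) (d T : ℕ) : Set (Ix d T → ℤ) :=
  {ω | (∀ s < T, |(nl ω s : ℝ)| ≤ bA ε β T) ∧ (∀ k, 1 ≤ k → k ≤ T + 1 → |(rl ω k : ℝ)| ≤ bR ε β k) ∧
    ∀ k, 1 ≤ k → k ≤ T + 1 → ∀ i, |(Nl ω k i : ℝ)| ≤ bB ε β d k}

lemma good_prob {d T : ℕ} (ε β : ℝ) (hε : 0 < ε) (hβ : 0 < β) (hd : 1 ≤ d) (hT : 1 ≤ T) :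
    ENNReal.ofReal (1 - β) ≤ Measure.pi (fun j => gm (prs ε hε d T hd j)) (goodSet ε β d T) := by
  classical
  set μ := Measure.pi (fun j => gm (prs ε hε d T hd j)) with hμ
  have hd' : (0:ℝ) < d := by exact_mod_cast hd
  have hT' : (0:ℝ) < T := by exact_mod_cast hT
  set U1 : Set (Ix d T → ℤ) := ⋃ s ∈ (Finset.univ : Finset (Fin T)),
    {ω | bA ε β T < |(ω (Sum.inr (Sum.inr s)) : ℝ)|} with hU1
  set U2 : Set (Ix d T → ℤ) := ⋃ k ∈ (Finset.univ : Finset (Fin (T+2))),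
    {ω | bR ε β k < |(ω (Sum.inr (Sum.inl k)) : ℝ)|} with hU2
  set U3 : Set (Ix d T → ℤ) := ⋃ k ∈ (Finset.Icc 1 (T+1)), ⋃ i ∈ (Finset.univ : Finset (Fin d)),
    {ω | bB ε β d k < |(Nl ω k i : ℝ)|} with hU3
  have h1 : μ U1 ≤ ENNReal.ofReal (β / 3) := by
    refine (measure_biUnion_finset_le _ _).trans ?_
    calc _ ≤ ∑ s : Fin T, ENNReal.ofReal (β / (3 * T)) :=
          Finset.sum_le_sum fun s _ => tailA ε β hε hβ hd hT s
      _ = ENNReal.ofReal (β / 3) := by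
          rw [← ENNReal.ofReal_sum_of_nonneg (fun _ _ => by positivity)]
          congr 1
          simp; field_simp
  have hw : ∀ k : ℕ, (0:ℝ) < β / 3 * (1 / ((k + 1) * (k + 2))) := fun k => by positivity
  have h2 : μ U2 ≤ ENNReal.ofReal (β / 3) := by
    refine (measure_biUnion_finset_le _ _).trans ?_
    calc _ ≤ ∑ k : Fin (T+2), ENNReal.ofReal (β / 3 * (1 / ((k.1 + 1) * (k.1 + 2)))) :=
          Finset.sum_le_sum fun k _ => tailR ε β hε hβ hd k
      _ ≤ ENNReal.ofReal (β / 3) := by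
          rw [← ENNReal.ofReal_sum_of_nonneg (fun k _ => (hw k.1).le)]
          apply ENNReal.ofReal_le_ofReal
          rw [Fin.sum_univ_eq_sum_range (fun k : ℕ => β / 3 * (1 / (((k:ℝ) + 1) * (k + 2)))), ← Finset.mul_sum]
          exact mul_le_of_le_one_right (by positivity) (tele _)
  have h3 : μ U3 ≤ ENNReal.ofReal (β / 3) := by
    refine (measure_biUnion_finset_le _ _).trans ?_
    calc _ ≤ ∑ k ∈ Finset.Icc 1 (T+1), ENNReal.ofReal (β / 3 * (1 / ((k + 1) * (k + 2)))) := by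
          refine Finset.sum_le_sum fun k hk => ?_
          have hk := Finset.mem_Icc.1 hk
          refine (measure_biUnion_finset_le _ _).trans ?_
          calc _ ≤ ∑ i : Fin d, ENNReal.ofReal (β / 3 * (1 / ((k + 1) * (k + 2))) / d) :=
                Finset.sum_le_sum fun i _ => tailB ε β hε hβ hd k hk.1 hk.2 i
            _ = _ := by
                rw [← ENNReal.ofReal_sum_of_nonneg (fun _ _ => (div_pos (hw k) hd').le)]
                congr 1
                rw [Finset.sum_const, nsmul_eq_mul]; simp only [Finset.card_univ, Fintype.card_fin]
                exact mul_div_cancel₀ _ hd'.ne'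
      _ ≤ ∑ k ∈ Finset.range (T+2), ENNReal.ofReal (β / 3 * (1 / ((k + 1) * (k + 2)))) := by
          refine Finset.sum_le_sum_of_subset fun k hk => ?_
          have := Finset.mem_Icc.1 hk
          exact Finset.mem_range.2 (by omega)
      _ ≤ ENNReal.ofReal (β / 3) := by
          rw [← ENNReal.ofReal_sum_of_nonneg (fun k _ => (hw k).le)]
          apply ENNReal.ofReal_le_ofReal
          rw [← Finset.mul_sum]
          exact mul_le_of_le_one_right (by positivity) (tele _)
  have hcov : (Set.univ : Set (Ix d T → ℤ)) ⊆ goodSet ε β d T ∪ (U1 ∪ (U2 ∪ U3)) := by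
    intro ω _
    by_contra hc
    simp only [Set.mem_union, not_or, hU1, hU2, hU3, Set.mem_iUnion, not_exists, Set.mem_ofPred_eq,
      not_lt, Finset.mem_univ, forall_true_left, Finset.mem_Icc] at hc
    obtain ⟨hg, g1, g2, g3⟩ := hc
    apply hg
    refine ⟨fun s hs => ?_, fun k hk1 hk2 => ?_, fun k hk1 hk2 i => g3 k ⟨hk1, hk2⟩ i⟩
    · unfold nl; rw [dif_pos hs]; exact g1 _
    · unfold rl; rw [dif_pos (by omega)]; exact g2 ⟨k, by omega⟩
  have htot : (1:ENNReal) ≤ μ (goodSet ε β d T) + ENNReal.ofReal β := by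
    have e : ENNReal.ofReal β = ENNReal.ofReal (β/3) + (ENNReal.ofReal (β/3) + ENNReal.ofReal (β/3)) := by
      rw [← ENNReal.ofReal_add (by positivity) (by positivity), ← ENNReal.ofReal_add (by positivity) (by positivity)]
      congr 1; ring
    calc (1:ENNReal) = μ Set.univ := by simp [hμ]
      _ ≤ _ := measure_mono hcov
      _ ≤ μ (goodSet ε β d T) + (μ U1 + (μ U2 + μ U3)) := by
          refine (measure_union_le _ _).trans ?_
          gcongr
          refine (measure_union_le _ _).trans ?_
          gcongr
          exact measure_union_le _ _
      _ ≤ _ := by rw [e]; gcongr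
  rw [ENNReal.ofReal_sub _ hβ.le, ENNReal.ofReal_one]
  exact tsub_le_iff_right.2 htot

lemma bA_nonneg (ε β : ℝ) (T : ℕ) (hε : 0 < ε) (hβ : 0 < β) (hβ1 : β < 1) (hT : 1 ≤ T) : 0 ≤ bA ε β T := by
  unfold bA
  have hT' : (1:ℝ) ≤ T := by exact_mod_cast hT
  have h1 := Real.log_nonneg (show (1:ℝ) ≤ 2 by norm_num)
  have h2 : 0 ≤ Real.log (1 / (β / (3 * T))) := Real.log_nonneg (by
    rw [one_div_div, le_div_iff₀ hβ]; nlinarith)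
  positivity

lemma bR_nonneg (ε β : ℝ) (k : ℕ) (hε : 0 < ε) (hβ : 0 < β) (hβ1 : β < 1) : 0 ≤ bR ε β k := by
  unfold bR
  have h1 := Real.log_nonneg (show (1:ℝ) ≤ 2 by norm_num)
  have h2 : 0 ≤ Real.log (1 / (β / 3 * (1 / ((k + 1) * (k + 2))))) := Real.log_nonneg (by
    have h : β / 3 * (1 / (((k:ℝ) + 1) * (k + 2))) ≤ 1 := by
      have : 1 / (((k:ℝ) + 1) * (k + 2)) ≤ 1 := by
        rw [div_le_one (by positivity)]
        nlinarith [(Nat.cast_nonneg k : (0:ℝ) ≤ k)]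
      have h0 : 0 ≤ 1 / (((k:ℝ) + 1) * (k + 2)) := by positivity
      nlinarith
    exact (one_le_div (by positivity)).2 h)
  positivity

lemma log2c_ge_one (z : ℝ) : 1 ≤ log2c z := by
  unfold log2c
  rw [Real.le_logb_iff_rpow_le (by norm_num) (by positivity)]
  simp

lemma log_le_log2c (z : ℝ) (hz : 0 < z) : Real.log z ≤ log2c z * Real.log 2 := by
  unfold log2c
  rw [Real.logb, div_mul_cancel₀ _ (Real.log_pos (by norm_num)).ne']
  exact Real.log_le_log hz (le_max_left _ _)

lemma numeric (ε β : ℝ) (d T n k : ℕ) (hε : 0 < ε) (hβ : 0 < β) (hβ1 : β < 1) (hd : 1 ≤ d)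
    (hT : 1 ≤ T) (hn : 1 ≤ n) (hk1 : 1 ≤ k) (hk : k ≤ 1 + d * n) :
    2 * bA ε β T + 2 * bR ε β k + bB ε β d k ≤
      500 * ε⁻¹ * ((d:ℝ) * (log2c ((d:ℝ) * n / β)) ^ 2 + log2c T) := by
  have hd' : (1:ℝ) ≤ d := by exact_mod_cast hd
  have hT' : (1:ℝ) ≤ T := by exact_mod_cast hT
  have hn' : (1:ℝ) ≤ n := by exact_mod_cast hn
  have hk1' : (1:ℝ) ≤ k := by exact_mod_cast hk1
  have hdn : (1:ℝ) ≤ d * n := by nlinarith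
  have hk' : (k:ℝ) ≤ 1 + d * n := by exact_mod_cast hk
  have l2p : 0 < Real.log 2 := Real.log_pos (by norm_num)
  have l2 : Real.log 2 ≤ 1 := by have := Real.log_two_lt_d9; linarith
  have l3 : Real.log 3 ≤ 2 := by
    have := Real.log_le_sub_one_of_pos (show (0:ℝ) < 3 by norm_num); linarith
  have l4 : Real.log 4 ≤ 2 := by
    rw [show (4:ℝ) = 2 ^ 2 by norm_num, Real.log_pow]; push_cast; linarith
  have hX1 := log2c_ge_one ((d:ℝ) * n / β)
  have hL1 := log2c_ge_one (T:ℝ)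
  have hX := log_le_log2c ((d:ℝ) * n / β) (by positivity)
  have hL := log_le_log2c (T:ℝ) (by positivity)
  set X := log2c ((d:ℝ) * n / β)
  set L := log2c (T:ℝ)
  rw [Real.log_div (by positivity) hβ.ne', Real.log_mul (by positivity) (by positivity)] at hX
  have hu : 0 ≤ Real.log d := Real.log_nonneg hd'
  have hv : 0 ≤ Real.log n := Real.log_nonneg hn'
  have hw : Real.log β < 0 := Real.log_neg hβ hβ1
  have hX2 : X * Real.log 2 ≤ X := by nlinarith
  have hL2 : L * Real.log 2 ≤ L := by nlinarith
  have hA : bA ε β T ≤ 16 * ε⁻¹ * (4 * X + L) := by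
    unfold bA
    rw [one_div_div, Real.log_div (by positivity) hβ.ne', Real.log_mul (by norm_num) (by positivity),
      show 2 / (ε / 8) = 16 * ε⁻¹ by field_simp; norm_num]
    refine mul_le_mul_of_nonneg_left ?_ (by positivity)
    linarith
  have hk2 : Real.log (((k:ℝ) + 1) * (k + 2)) ≤ 4 + 2 * (Real.log d + Real.log n) := by
    have : ((k:ℝ) + 1) * (k + 2) ≤ (3 * (d * n)) * (4 * (d * n)) := by
      apply mul_le_mul <;> first | positivity | linarith
    have h := Real.log_le_log (by positivity) this
    have e0 : Real.log ((d:ℝ) * n) = Real.log d + Real.log n :=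
      Real.log_mul (by positivity) (by positivity)
    have e1 : Real.log (3 * ((d:ℝ) * n)) = Real.log 3 + Real.log ((d:ℝ) * n) :=
      Real.log_mul (by positivity) (by positivity)
    have e2 : Real.log (4 * ((d:ℝ) * n)) = Real.log 4 + Real.log ((d:ℝ) * n) :=
      Real.log_mul (by positivity) (by positivity)
    have e3 : Real.log ((3 * ((d:ℝ) * n)) * (4 * (d * n))) =
        Real.log (3 * ((d:ℝ) * n)) + Real.log (4 * ((d:ℝ) * n)) :=
      Real.log_mul (by positivity) (by positivity)
    linarith
  have hlogw : Real.log (β / 3 * (1 / (((k:ℝ) + 1) * (k + 2)))) =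
      Real.log β - Real.log 3 - Real.log (((k:ℝ) + 1) * (k + 2)) := by
    rw [Real.log_mul (by positivity) (by positivity), Real.log_div hβ.ne' (by norm_num), one_div,
      Real.log_inv]; ring
  have hR : bR ε β k ≤ 8 * ε⁻¹ * (9 * X) := by
    unfold bR
    rw [one_div (β / 3 * _), Real.log_inv, hlogw, show 2 / (ε / 4) = 8 * ε⁻¹ by field_simp; norm_num]
    gcongr
    linarith
  have he : (Nat.log 2 k : ℝ) ≤ 1 + X := by
    have h1 : ((2:ℝ) ^ Nat.log 2 k) ≤ 2 * (d * n) := by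
      have : ((2:ℝ) ^ Nat.log 2 k) ≤ k := by exact_mod_cast Nat.pow_log_le_self 2 (by omega)
      linarith
    have h := Real.log_le_log (by positivity) h1
    rw [Real.log_pow, Real.log_mul (by positivity) (by positivity),
      Real.log_mul (by positivity) (by positivity)] at h
    have : (Nat.log 2 k : ℝ) * Real.log 2 ≤ (1 + X) * Real.log 2 := by linarith
    exact le_of_mul_le_mul_right this l2p
  have he0 : (0:ℝ) ≤ Nat.log 2 k := Nat.cast_nonneg _
  have hB : bB ε β d k ≤ 4 * d * ε⁻¹ * (3 * X) * (13 * X) := by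
    unfold bB
    rw [one_div (_ / (d:ℝ)), Real.log_inv, Real.log_div (by positivity) (by positivity), hlogw,
      show 2 / (ε / (2 * (d:ℝ) * (Nat.log 2 k + 1))) = 4 * d * ε⁻¹ * (Nat.log 2 k + 1) by
        field_simp; norm_num]
    have a1 : 2 * (Nat.log 2 k : ℝ) * Real.log 2 ≤ 4 * X := by nlinarith
    have a2 : 2 * (Nat.log 2 k : ℝ) * Real.log 2 + -(Real.log β - Real.log 3 -
        Real.log (((k:ℝ) + 1) * (k + 2)) - Real.log d) ≤ 13 * X := by
      linarith
    have a3 : (Nat.log 2 k + 1 : ℝ) ≤ 3 * X := by linarith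
    calc _ ≤ 4 * d * ε⁻¹ * (Nat.log 2 k + 1) * (13 * X) := by gcongr
      _ ≤ _ := by gcongr
  have hXX : X ≤ d * X ^ 2 := by nlinarith [mul_nonneg (sub_nonneg.2 hd') (sq_nonneg X)]
  have hi : 0 < ε⁻¹ := by positivity
  have : 2 * bA ε β T + 2 * bR ε β k + bB ε β d k ≤
      ε⁻¹ * (32 * (4 * X + L) + 16 * (9 * X) + 156 * (d * X ^ 2)) := by
    have e : 4 * d * ε⁻¹ * (3 * X) * (13 * X) = ε⁻¹ * (156 * (d * X ^ 2)) := by ring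
    rw [e] at hB
    linarith
  refine this.trans ?_
  rw [mul_comm (500:ℝ), mul_assoc]
  gcongr
  linarith

lemma Hx_hist {d T : ℕ} (x : Fin T → Fin d → Bool) (t : Fin T) (i : Fin d) :
    Hx x (t + 1) i = (hist x t i : ℤ) := by
  unfold Hx hist
  push_cast
  refine Finset.sum_congr rfl fun s _ => ?_
  have : s.1 < t.1 + 1 ↔ s ≤ t := by rw [Fin.le_def]; omega
  simp only [this]

lemma Hx_mono {d T : ℕ} (x : Fin T → Fin d → Bool) : Monotone (Hx x) := by
  intro a b hab i
  refine Finset.sum_le_sum fun s _ => ?_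
  by_cases h : s.1 < a ∧ x s i
  · rw [if_pos h, if_pos ⟨by omega, h.2⟩]
  · rw [if_neg h]; split_ifs <;> simp

lemma mx_sup {d : ℕ} [NeZero d] (f : Fin d → ℕ) (v : Fin d → ℤ) (h : ∀ i, v i = (f i : ℤ)) :
    mx v = ((Finset.univ.sup f : ℕ) : ℤ) := by
  apply le_antisymm
  · obtain ⟨i, hi⟩ := exists_mx v
    rw [hi, h]
    exact_mod_cast Finset.le_sup (f := f) (Finset.mem_univ i)
  · obtain ⟨i, _, hi⟩ := Finset.exists_mem_eq_sup (Finset.univ : Finset (Fin d)) Finset.univ_nonempty f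
    rw [hi, ← h]
    exact le_mx v i

lemma final_acc {d T : ℕ} [NeZero d] (ε β : ℝ) (hε : 0 < ε) (hβ : 0 < β) (hβ1 : β < 1) (hd : 1 ≤ d)
    (hT : 1 ≤ T) (x : Fin T → Fin d → Bool) (ω : Ix d T → ℤ) (hω : ω ∈ goodSet ε β d T) (t : Fin T) :
    |((rn (fun k => bA ε β T + bR ε β k) x ω (t + 1)).2 : ℝ) -
      ((Finset.univ.sup fun i : Fin d => hist x t i : ℕ) : ℝ)| ≤
      500 * ε⁻¹ * ((d : ℝ) * (log2c ((d : ℝ) *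
        ((Finset.univ.sup fun j : Fin d => hist x (lastIdx T hT) j : ℕ) : ℝ) / β)) ^ 2
        + log2c (T : ℝ)) := by
  obtain ⟨g1, g2, g3⟩ := hω
  have ht := t.2
  have H0 : Hx x 0 = 0 := by funext i; simp [Hx]
  have N1 : Nl ω 1 = 0 := by funext i; simp [Nl, nodes]
  have hm := Hx_mono x
  obtain ⟨s, hs, h1, h2, h3⟩ := run_acc (fun k => bA ε β T + bR ε β k) (Hx x) (Nl ω) (rl ω) (nl ω)
    (bA ε β T) (bR ε β) H0 N1 hm (t+1) (fun k => rfl) (fun s hs => g1 s (by omega))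
    (bA_nonneg ε β T hε hβ hβ1 hT) (fun k => bR_nonneg ε β k hε hβ hβ1)
    (fun k hk hk' => g2 k hk (by omega))
  have hk1 := run_pos (fun k => bA ε β T + bR ε β k) (Hx x) (Nl ω) (rl ω) (nl ω) (t+1)
  have hk2 := run_le (fun k => bA ε β T + bR ε β k) (Hx x) (Nl ω) (rl ω) (nl ω) (t+1)
  change _ = mx (Hx x s + Nl ω (rn _ x ω (t+1)).1) at h1
  set r := rn (fun k => bA ε β T + bR ε β k) x ω with hr
  set n := (Finset.univ.sup fun j : Fin d => hist x (lastIdx T hT) j : ℕ) with hn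
  have hlast : ∀ u ≤ T, ∀ i, Hx x u i ≤ n := by
    intro u hu i
    have e : (lastIdx T hT : ℕ) + 1 = T := by simp [lastIdx]; omega
    have a := hm hu i
    have b := Hx_hist x (lastIdx T hT) i
    rw [e] at b
    have c : hist x (lastIdx T hT) i ≤ n :=
      Finset.le_sup (f := fun j => hist x (lastIdx T hT) j) (Finset.mem_univ i)
    have c' : (hist x (lastIdx T hT) i : ℤ) ≤ n := by exact_mod_cast c
    linarith
  have hnn : ∀ u i, 0 ≤ Hx x u i := fun u i => Finset.sum_nonneg fun s _ => by split_ifs <;> simp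
  have hsum : ∑ i, Hx x s i ≤ d * n := by
    calc _ ≤ ∑ i : Fin d, (n:ℤ) := Finset.sum_le_sum fun i _ => hlast s (by omega) i
      _ = _ := by simp
  have hkn : (r (t+1)).1 ≤ 1 + d * n := by
    have : ((r (t+1)).1 : ℤ) ≤ 1 + d * n := h2.trans (by linarith)
    exact_mod_cast this
  have hmt : ((Finset.univ.sup fun i : Fin d => hist x t i : ℕ) : ℝ) = (mx (Hx x (t+1)) : ℝ) := by
    rw [mx_sup (fun i => hist x t i) _ (fun i => Hx_hist x t i)]; simp
  rw [hmt]
  rcases Nat.eq_zero_or_pos n with h0 | hpos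
  · have hz : ∀ u ≤ T, Hx x u = 0 := fun u hu => funext fun i => by
      have := hlast u hu i
      have := hnn u i
      simp only [Pi.zero_apply]
      omega
    have hk : (r (t+1)).1 = 1 := by
      rw [h0] at hkn; change 1 ≤ (r (t+1)).1 at hk1; omega
    have e : (r (t+1)).2 = 0 := by
      change (r (t+1)).2 = _ at h1
      rw [h1, hk, N1, hz s (by omega)]; simp [mx]
    rw [e, hz _ (by omega)]
    have := log2c_ge_one T
    have e2 : mx (0 : Fin d → ℤ) = 0 := by simp [mx]
    rw [e2]
    simp only [sub_self, Int.cast_zero, abs_zero]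
    positivity
  · refine le_trans ?_ (numeric ε β d T n (r (t+1)).1 hε hβ hβ1 hd hT hpos hk1 hkn)
    change (r (t+1)).2 = _ at h1
    have hB := g3 (r (t+1)).1 hk1 (by change (r (t+1)).1 ≤ _ at hk2; omega)
    have b1 := mx_le_add (Hx x (t+1) + Nl ω (r (t+1)).1) (Hx x (t+1)) (bB ε β d (r (t+1)).1)
      (fun i => by
        have := abs_le.1 (hB i)
        simp only [Pi.add_apply]; push_cast; linarith)
    have b2 := mx_le_add (Hx x (t+1)) (Hx x (t+1) + Nl ω (r (t+1)).1) (bB ε β d (r (t+1)).1)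
      (fun i => by
        have := abs_le.1 (hB i)
        simp only [Pi.add_apply]; push_cast; linarith)
    have b3 := mx_le_add (Hx x s + Nl ω (r (t+1)).1) (Hx x (t+1) + Nl ω (r (t+1)).1) 0
      (fun i => by
        have : (Hx x s i : ℝ) ≤ Hx x (t+1) i := by exact_mod_cast hm hs i
        simp only [Pi.add_apply]; push_cast; linarith)
    rw [← h1] at b3
    change ((mx (Hx x (t+1) + Nl ω (r (t+1)).1) : ℝ) - ((r (t+1)).2 : ℝ)) ≤
      2 * bA ε β T + 2 * bR ε β (r (t+1)).1 at h3
    have p1 := bA_nonneg ε β T hε hβ hβ1 hT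
    have p2 := bR_nonneg ε β (r (t+1)).1 hε hβ hβ1
    rw [abs_le]
    constructor <;> linarith

theorem maxsum_continual_observation :
    ∃ C : ℝ, 0 < C ∧
      ∀ (ε β : ℝ) (d T : ℕ) (_hε : 0 < ε) (_hβ : β ∈ Set.Ioo (0 : ℝ) 1)
        (_hd : 1 ≤ d) (hT : 1 ≤ T),
        ∃ M : (Fin T → Fin d → Bool) → Measure (Fin T → ℝ),
          IsCOMech M ∧ IsEventDP ε M ∧
          ∀ x, ENNReal.ofReal (1 - β) ≤
            M x {a | ∀ t : Fin T,
              |a t - ((Finset.univ.sup fun i : Fin d => hist x t i : ℕ) : ℝ)| ≤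
                C * ε⁻¹ * ((d : ℝ) *
                    (log2c ((d : ℝ) *
                      ((Finset.univ.sup fun j : Fin d => hist x (lastIdx T hT) j : ℕ) : ℝ)
                        / β)) ^ 2
                  + log2c (T : ℝ))} := by
  refine ⟨500, by norm_num, ?_⟩
  intro ε β d T hε hβ hd hT
  haveI : NeZero d := ⟨by omega⟩
  set θ : ℕ → ℝ := fun k => bA ε β T + bR ε β k with hθ
  set μ := Measure.pi (fun j : Ix d T => gm (prs ε hε d T hd j)) with hμ
  let F : (Fin T → Fin d → Bool) → (Ix d T → ℤ) → Fin T → ℝ :=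
    fun x ω t => ((rn θ x ω (t + 1)).2 : ℝ)
  have hF : ∀ x, Measurable (F x) := fun x => measurable_of_countable _
  refine ⟨fun x => μ.map (F x), ⟨measurable_of_countable _, ?_, ?_⟩, ?_, ?_⟩
  · intro x
    exact Measure.isProbabilityMeasure_map (hF x).aemeasurable
  · intro t x y hxy
    have hm : Measurable (fun (a : Fin T → ℝ) (s : {s : Fin T // s ≤ t}) => a s.1) := by fun_prop
    simp only
    rw [Measure.map_map hm (hF x), Measure.map_map hm (hF y)]
    congr 1
    funext ω s
    simp only [Function.comp, F]
    congr 2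
    refine run_congr _ _ _ _ _ _ _ fun u hu => ?_
    funext i
    refine Finset.sum_congr rfl fun v _ => ?_
    have hs : s.1.1 ≤ t.1 := s.2
    by_cases hv : v ≤ t
    · rw [hxy v hv]
    · have : ¬ (v.1 < u) := by rw [Fin.le_def] at hv; omega
      rw [if_neg (fun h => this h.1), if_neg (fun h => this h.1)]
  · rintro x y ⟨t₀, hxy⟩ S hS
    refine pi_dp (prs ε hε d T hd) (F x) (F y) (fun ω => shf (rn θ x ω) t₀
      (fun i => (if x t₀ i then 1 else 0) - (if y t₀ i then 1 else 0))) ?_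
      (rn_inj θ x y t₀ hxy) ε ?_ S hS
    · intro ω
      funext t
      simp only [F]
      rw [rn_align θ x y t₀ hxy ω (t+1) t.2]
    · intro ω
      exact sh_cost ε hε θ x t₀ _ (fun i => by split_ifs <;> simp) ω
  · intro x
    refine le_trans ?_ (Measure.le_map_apply (hF x).aemeasurable _)
    refine (good_prob ε β hε hβ.1 hd hT).trans (measure_mono ?_)
    intro ω hω t
    exact final_acc ε β hε hβ.1 hβ.2 hd hT x ω hω t
end
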